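/- arXiv:2311.09065 — 4 statements merged into one kernel-verified Lean document; each statement's English description precedes it below -/
import Mathlib

section
/- Given ε>0, under Assumptions (A1)–(A5), let {x^k, y^k, z^k} be generated by DPALM with β_k, v_k as in the parameter choice, where each x^{k+1} satisfies dist(0, ∂_x L̃_{β_k}(x^{k+1}; y^k, z^k)) ≤ ε_k := min{ε/8, √(ρ/(2β_k)), 1}, with L̃_{β_k}(x; y, z) := L_{β_k}(x; y, z) + ρ‖x − x^k‖². Then for some k < K := K₁ + K₂, where K₁ := ⌈max{C_p²/(β₀²ε²), (4B_p + 5C_p²)²/(16β₀²ε²)}⌉ and K₂ := ⌈5 C_x ρ ε⁻²⌉, the iterate x^{k+1} is an ε-KKT point of problem (P). -/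
noncomputable section

open scoped RealInnerProductSpace
open Metric

/-- Convex subdifferential of `φ` relative to the set `X` (the effective domain):
`∂φ(x) = {ξ | ∀ u ∈ X, φ(u) ≥ φ(x) + ⟨ξ, u − x⟩}`. -/
def csubdiff {E : Type*} [NormedAddCommGroup E] [InnerProductSpace ℝ E]
    (X : Set E) (φ : E → ℝ) (x : E) : Set E :=
  {ξ | ∀ u ∈ X, φ x + ⟪ξ, u - x⟫ ≤ φ u}

/-- Subdifferential of a `ρ`-weakly convex function `φ` (relative to the domain `X`):
`∂φ(x) := ∂(φ + (ρ/2)‖·‖²)(x) − ρx`, the latter being the convex subdifferential. -/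
def wsubdiff {E : Type*} [NormedAddCommGroup E] [InnerProductSpace ℝ E]
    (X : Set E) (ρ : ℝ) (φ : E → ℝ) (x : E) : Set E :=
  {ξ | ξ + ρ • x ∈ csubdiff X (fun u => φ u + ρ / 2 * ‖u‖ ^ 2) x}

open Classical in
/-- Moore–Penrose pseudoinverse of a continuous linear map on a real inner product space
(defined via its characterizing equations; `0` if no such map exists). -/
def mpPinv {F : Type*} [NormedAddCommGroup F] [InnerProductSpace ℝ F] [CompleteSpace F]
    (T : F →L[ℝ] F) : F →L[ℝ] F :=
  if hT : ∃ S : F →L[ℝ] F,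
      T.comp (S.comp T) = T ∧ S.comp (T.comp S) = S ∧
      ContinuousLinearMap.adjoint (T.comp S) = T.comp S ∧
      ContinuousLinearMap.adjoint (S.comp T) = S.comp T
  then hT.choose else 0

section Subdifferential

variable {E : Type*} [NormedAddCommGroup E] [InnerProductSpace ℝ E]

theorem HasFDerivAt.apply_le_of_forall_line_le {φ : E → ℝ} {φ' : E →L[ℝ] ℝ} {x v : E} {c e : ℝ}
    (hφ : HasFDerivAt φ φ' x)
    (h : ∀ t : ℝ, 0 < t → t ≤ 1 → φ (x + t • v) ≤ φ x + t * c + t ^ 2 * e) : φ' v ≤ c := by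
  have h1 := (hφ.hasLineDerivAt v).tendsto_slope_zero_right
  have h2 : Filter.Tendsto (fun t : ℝ => c + t * e) (nhdsWithin 0 (Set.Ioi 0)) (nhds c) := by
    have : Filter.Tendsto (fun t : ℝ => c + t * e) (nhds 0) (nhds (c + 0 * e)) :=
      (Continuous.tendsto (by fun_prop) 0)
    rw [zero_mul, add_zero] at this
    exact this.mono_left nhdsWithin_le_nhds
  refine le_of_tendsto_of_tendsto h1 h2 ?_
  have h3 : Set.Ioc (0 : ℝ) 1 ∈ nhdsWithin (0 : ℝ) (Set.Ioi 0) := Ioc_mem_nhdsGT one_pos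
  filter_upwards [h3] with t ht
  have := h t ht.1 ht.2
  rw [smul_eq_mul, inv_mul_le_iff₀ ht.1]
  linarith

theorem norm_add_smul_sq (x v : E) (t : ℝ) :
    ‖x + t • v‖ ^ 2 = ‖x‖ ^ 2 + 2 * t * ⟪x, v⟫ + t ^ 2 * ‖v‖ ^ 2 := by
  rw [norm_add_sq_real, inner_smul_right, norm_smul, mul_pow, Real.norm_eq_abs, sq_abs]
  ring

theorem isClosed_csubdiff (X : Set E) (φ : E → ℝ) (x : E) : IsClosed (csubdiff X φ x) := by
  have : csubdiff X φ x = ⋂ u ∈ X, {ξ | φ x + ⟪ξ, u - x⟫ ≤ φ u} := by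
    ext ξ
    simp [csubdiff]
  rw [this]
  exact isClosed_biInter fun u _ => isClosed_le (by fun_prop) continuous_const

theorem eq_zero_of_inner_nonpos_of_mem_interior {X : Set E} {x w : E} (hx : x ∈ interior X)
    (hw : ∀ u ∈ X, ⟪w, u - x⟫ ≤ 0) : w = 0 := by
  obtain ⟨r, hr, hball⟩ := Metric.mem_nhds_iff.1 (mem_interior_iff_mem_nhds.1 hx)
  by_contra hw0
  have hn : 0 < ‖w‖ := norm_pos_iff.2 hw0
  have h1 := hw (x + (r / 2 / ‖w‖) • w) (hball (by
    rw [mem_ball, dist_eq_norm, add_sub_cancel_left, norm_smul, Real.norm_of_nonneg (by positivity),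
      div_mul_cancel₀ _ hn.ne']
    linarith))
  rw [add_sub_cancel_left, real_inner_smul_right, real_inner_self_eq_norm_sq] at h1
  have : 0 < r / 2 / ‖w‖ * ‖w‖ ^ 2 := by positivity
  linarith

theorem ball_infDist_frontier_subset {X : Set E} {x : E} (hx : x ∈ interior X) :
    ball x (infDist x (frontier X)) ⊆ X := by
  by_contra hcon
  obtain ⟨u, hu, huX⟩ := Set.not_subset.1 hcon
  have hr : 0 < infDist x (frontier X) := dist_nonneg.trans_lt (mem_ball.1 hu)
  have hconn := (convex_ball x (infDist x (frontier X))).isPreconnected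
  have hsub : ball x (infDist x (frontier X)) ⊆ interior X ∪ (closure X)ᶜ := by
    intro y hy
    by_contra hy'
    simp only [Set.mem_union, Set.mem_compl_iff, not_or, not_not] at hy'
    have : infDist x (frontier X) ≤ dist x y := infDist_le_dist_of_mem ⟨hy'.2, hy'.1⟩
    rw [mem_ball, dist_comm] at hy
    linarith
  obtain ⟨y, -, hy1, hy2⟩ := hconn _ _ isOpen_interior isClosed_closure.isOpen_compl hsub
    ⟨x, mem_ball_self hr, hx⟩
    ⟨u, hu, (hsub hu).resolve_left fun h => huX (interior_subset h)⟩
  exact hy2 (interior_subset_closure hy1)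

/-- If the subgradients of a lower semicontinuous `h` are normal vectors plus vectors of norm at
most `r`, then every point of the convex body `X` has a subgradient of norm at most `r`. -/
theorem exists_csubdiff_norm_le {X : Set E} {h : E → ℝ} {r : ℝ} [ProperSpace E]
    (hX : Convex ℝ X) (hne : ∀ u ∈ X, (csubdiff X h u).Nonempty) (hlsc : LowerSemicontinuous h)
    (hsub : ∀ u ∈ X, ∀ ξ ∈ csubdiff X h u,
      ∃ w v, ξ = w + v ∧ (∀ u' ∈ X, ⟪w, u' - u⟫ ≤ 0) ∧ ‖v‖ ≤ r)
    {x₀ x : E} (hx₀ : x₀ ∈ interior X) (hx : x ∈ X) : ∃ ζ ∈ csubdiff X h x, ‖ζ‖ ≤ r := by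
  let s : ℕ → ℝ := fun j => 1 / ((j : ℝ) + 1)
  have hs0 : ∀ j, 0 < s j := fun j => Nat.one_div_pos_of_nat
  have hs1 : ∀ j, s j ≤ 1 := fun j => by
    simp only [s]
    rw [div_le_one (by positivity)]
    linarith [(Nat.cast_nonneg j : (0 : ℝ) ≤ j)]
  let X' : ℕ → E := fun j => x + s j • (x₀ - x)
  have hX' : ∀ j, X' j ∈ interior X := fun j =>
    hX.add_smul_sub_mem_interior hx hx₀ ⟨hs0 j, hs1 j⟩
  have hlim : Filter.Tendsto X' Filter.atTop (nhds x) := by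
    have : Filter.Tendsto X' Filter.atTop (nhds (x + (0 : ℝ) • (x₀ - x))) :=
      tendsto_const_nhds.add (tendsto_one_div_add_atTop_nhds_zero_nat.smul_const _)
    simpa using this
  have hζ : ∀ j, ∃ ζ ∈ csubdiff X h (X' j), ‖ζ‖ ≤ r := by
    intro j
    obtain ⟨ξ, hξ⟩ := hne _ (interior_subset (hX' j))
    obtain ⟨w, v, rfl, hw, hv⟩ := hsub _ (interior_subset (hX' j)) ξ hξ
    obtain rfl := eq_zero_of_inner_nonpos_of_mem_interior (hX' j) hw
    exact ⟨_, hξ, by simpa using hv⟩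
  choose ζ hζ hζr using hζ
  obtain ⟨ζ', hζ', φ, hφ, hφlim⟩ := (isCompact_closedBall (0 : E) r).tendsto_subseq
    (x := ζ) (fun j => by simpa using hζr j)
  refine ⟨ζ', fun u hu => ?_, by simpa using hζ'⟩
  have hX'φ := hlim.comp hφ.tendsto_atTop
  have hin : Filter.Tendsto (fun j => ⟪ζ (φ j), u - X' (φ j)⟫) Filter.atTop
      (nhds ⟪ζ', u - x⟫) := hφlim.inner (tendsto_const_nhds.sub hX'φ)
  refine le_of_forall_pos_le_add fun e he => ?_
  have h1 := hX'φ.eventually (hlsc x (h x - e / 2) (by linarith))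
  have h2 := hin.eventually (eventually_gt_nhds (show ⟪ζ', u - x⟫ - e / 2 < ⟪ζ', u - x⟫ by linarith))
  obtain ⟨j, hj1, hj2⟩ := (h1.and h2).exists
  have h3 := hζ (φ j) u hu
  simp only [Function.comp] at hj1
  linarith

theorem infDist_frontier_mul_norm_le {X : Set E} {x₀ x w : E} (hx₀ : x₀ ∈ interior X)
    (hw : ∀ u ∈ X, ⟪w, u - x⟫ ≤ 0) :
    infDist x₀ (frontier X) * ‖w‖ ≤ ⟪w, x - x₀⟫ := by
  have h0 := hw x₀ (interior_subset hx₀)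
  have hneg : ⟪w, x - x₀⟫ = -⟪w, x₀ - x⟫ := by rw [← inner_neg_right, neg_sub]
  rcases eq_or_ne w 0 with rfl | hw0
  · simp
  have hn : 0 < ‖w‖ := norm_pos_iff.2 hw0
  rw [← le_div_iff₀ hn]
  refine le_of_forall_lt_imp_le_of_dense fun s hs => ?_
  rw [le_div_iff₀ hn]
  rcases le_or_gt s 0 with hs0 | hs0
  · nlinarith
  have h1 := hw (x₀ + (s / ‖w‖) • w) (ball_infDist_frontier_subset hx₀ (by
    rwa [mem_ball, dist_eq_norm, add_sub_cancel_left, norm_smul,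
      Real.norm_of_nonneg (by positivity), div_mul_cancel₀ _ hn.ne']))
  rw [show x₀ + (s / ‖w‖) • w - x = (x₀ - x) + (s / ‖w‖) • w by abel, inner_add_right,
    real_inner_smul_right, real_inner_self_eq_norm_sq,
    show s / ‖w‖ * ‖w‖ ^ 2 = s * ‖w‖ by field_simp] at h1
  linarith

variable [CompleteSpace E]

theorem inner_gradient_le_of_forall_line_le {φ : E → ℝ} {x v : E} {c e : ℝ}
    (hφ : DifferentiableAt ℝ φ x)
    (h : ∀ t : ℝ, 0 < t → t ≤ 1 → φ (x + t • v) ≤ φ x + t * c + t ^ 2 * e) :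
    ⟪gradient φ x, v⟫ ≤ c := by
  have h1 := hφ.hasGradientAt.hasFDerivAt.apply_le_of_forall_line_le h
  simpa using h1

theorem le_inner_gradient_of_forall_line_le {φ : E → ℝ} {x v : E} {c e : ℝ}
    (hφ : DifferentiableAt ℝ φ x)
    (h : ∀ t : ℝ, 0 < t → t ≤ 1 → φ x + t * c + t ^ 2 * e ≤ φ (x + t • v)) :
    c ≤ ⟪gradient φ x, v⟫ := by
  have h1 := hφ.hasGradientAt.hasFDerivAt.neg.apply_le_of_forall_line_le (c := -c) (e := -e)
    (v := v) (fun t h0 ht => by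
      have := h t h0 ht
      simp only [Pi.neg_apply]
      linarith)
  simp only [neg_apply, InnerProductSpace.toDual_apply_apply] at h1
  linarith

theorem ConvexOn.inner_gradient_le {X : Set E} {φ : E → ℝ} {x u : E} (hφ : ConvexOn ℝ X φ)
    (hx : x ∈ X) (hu : u ∈ X) (hd : DifferentiableAt ℝ φ x) :
    φ x + ⟪gradient φ x, u - x⟫ ≤ φ u := by
  have := inner_gradient_le_of_forall_line_le (v := u - x) (c := φ u - φ x) (e := 0) hd
    (fun t h0 h1 => by
      have h2 := hφ.2 hx hu (sub_nonneg.2 h1) h0.le (by ring)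
      rw [show (1 - t) • x + t • u = x + t • (u - x) by module] at h2
      simp only [smul_eq_mul] at h2
      linarith)
  linarith

theorem gradient_mem_wsubdiff {X : Set E} {ρ : ℝ} {f : E → ℝ} {x : E}
    (hf : ConvexOn ℝ X (fun u => f u + ρ / 2 * ‖u‖ ^ 2)) (hx : x ∈ X)
    (hd : DifferentiableAt ℝ f x) : gradient f x ∈ wsubdiff X ρ f x := by
  intro u hu
  have := inner_gradient_le_of_forall_line_le (v := u - x)
    (c := f u + ρ / 2 * ‖u‖ ^ 2 - (f x + ρ / 2 * ‖x‖ ^ 2) - ρ * ⟪x, u - x⟫)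
    (e := -(ρ / 2 * ‖u - x‖ ^ 2)) hd
    (fun t h0 h1 => by
      have h2 := hf.2 hx hu (sub_nonneg.2 h1) h0.le (by ring)
      rw [show (1 - t) • x + t • u = x + t • (u - x) by module] at h2
      simp only [smul_eq_mul, norm_add_smul_sq] at h2
      linarith)
  simp only [inner_add_left, real_inner_smul_left]
  linarith

theorem weaklyConvex_inner_gradient_le {X : Set E} {ρ : ℝ} {f : E → ℝ} {x u : E}
    (hf : ConvexOn ℝ X (fun u => f u + ρ / 2 * ‖u‖ ^ 2)) (hx : x ∈ X) (hu : u ∈ X)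
    (hd : DifferentiableAt ℝ f x) :
    f x + ⟪gradient f x, u - x⟫ - ρ / 2 * ‖u - x‖ ^ 2 ≤ f u := by
  have h := gradient_mem_wsubdiff hf hx hd u hu
  have h2 := norm_add_smul_sq x (u - x) 1
  rw [one_smul, add_sub_cancel] at h2
  simp only [inner_add_left, real_inner_smul_left] at h
  rw [h2] at h
  linarith

theorem inner_sub_gradient_nonpos_of_mem_wsubdiff {X : Set E} {ρ : ℝ} {f : E → ℝ} {x ξ u : E}
    (hX : Convex ℝ X) (hx : x ∈ X) (hd : DifferentiableAt ℝ f x) (hξ : ξ ∈ wsubdiff X ρ f x)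
    (hu : u ∈ X) : ⟪ξ - gradient f x, u - x⟫ ≤ 0 := by
  have := le_inner_gradient_of_forall_line_le (v := u - x) (c := ⟪ξ, u - x⟫)
    (e := -(ρ / 2 * ‖u - x‖ ^ 2)) hd
    (fun t h0 h1 => by
      have h2 := hξ (x + t • (u - x)) (hX.add_smul_sub_mem hx hu ⟨h0.le, h1⟩)
      simp only [norm_add_smul_sq, add_sub_cancel_left, inner_add_left, inner_smul_right,
        real_inner_smul_left] at h2
      linarith)
  rw [inner_sub_left]
  linarith

theorem gradient_add_mem_wsubdiff {X : Set E} {ρ : ℝ} {f h : E → ℝ} {x ζ : E}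
    (hf : ConvexOn ℝ X (fun u => f u + ρ / 2 * ‖u‖ ^ 2)) (hx : x ∈ X)
    (hd : DifferentiableAt ℝ f x) (hζ : ζ ∈ csubdiff X h x) :
    gradient f x + ζ ∈ wsubdiff X ρ (fun u => f u + h u) x := by
  intro u hu
  have h1 := gradient_mem_wsubdiff hf hx hd u hu
  have h2 := hζ u hu
  simp only [inner_add_left] at h1 h2 ⊢
  linarith

theorem exists_mem_csubdiff_norm_le {X : Set E} {ρ δ : ℝ} {f h : E → ℝ} {x c₁ c₂ c₃ : E}
    [ProperSpace E]
    (hf : ConvexOn ℝ X (fun u => f u + ρ / 2 * ‖u‖ ^ 2)) (hx : x ∈ X)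
    (hd : DifferentiableAt ℝ f x) (hne : (csubdiff X h x).Nonempty)
    (hδ : infDist (0 : E) {w | ∃ ξf ∈ wsubdiff X ρ f x, ∃ ξh ∈ csubdiff X h x,
      w = ξf + ξh + c₁ + c₂ + c₃} ≤ δ) :
    ∃ ζ ∈ csubdiff X h x, ‖gradient f x + ζ + c₁ + c₂ + c₃‖ ≤ δ := by
  have hset : {w | ∃ ξf ∈ wsubdiff X ρ f x, ∃ ξh ∈ csubdiff X h x,
      w = ξf + ξh + c₁ + c₂ + c₃} =
      (fun ζ => (gradient f x + c₁ + c₂ + c₃) + ζ) '' csubdiff X h x := by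
    ext w
    simp only [Set.mem_ofPred_eq, Set.mem_image]
    constructor
    · rintro ⟨ξf, hξf, ξh, hξh, rfl⟩
      refine ⟨ξf - gradient f x + ξh, fun u hu => ?_, by abel⟩
      have h1 := inner_sub_gradient_nonpos_of_mem_wsubdiff hf.1 hx hd hξf hu
      have h2 := hξh u hu
      rw [inner_add_left]
      linarith
    · rintro ⟨ζ, hζ, rfl⟩
      exact ⟨gradient f x, gradient_mem_wsubdiff hf hx hd, ζ, hζ, by abel⟩
  rw [hset] at hδ
  have hcl : IsClosed ((fun ζ => (gradient f x + c₁ + c₂ + c₃) + ζ) '' csubdiff X h x) :=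
    (Homeomorph.addLeft _).isClosedMap _ (isClosed_csubdiff X h x)
  obtain ⟨w, ⟨ζ, hζ, rfl⟩, hw⟩ := hcl.exists_infDist_eq_dist (hne.image _) 0
  refine ⟨ζ, hζ, ?_⟩
  rw [hw, dist_zero_left] at hδ
  rwa [show gradient f x + ζ + c₁ + c₂ + c₃ = (gradient f x + c₁ + c₂ + c₃) + ζ by abel]

end Subdifferential
section ScalarMultiplier

variable {z β α s : ℝ}

theorem max_neg_div_eq (hβ : 0 < β) :
    max (-z / β) s = (max (z + β * s) 0 - z) / β := by
  rw [eq_div_iff hβ.ne', max_mul_of_nonneg _ _ hβ.le, div_mul_cancel₀ _ hβ.ne', max_comm,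
    ← max_sub_sub_right]
  congr 1 <;> ring

theorem two_mul_max_mul_eq :
    2 * β * (max (z + β * s) 0 * s) =
      max (z + β * s) 0 ^ 2 - z ^ 2 + (max (z + β * s) 0 - z) ^ 2 := by
  rcases max_cases (z + β * s) 0 with ⟨h, -⟩ | ⟨h, -⟩ <;> rw [h] <;> ring

theorem sq_mul_max_sq_le (hz : 0 ≤ z) (hβ : 0 < β) :
    β ^ 2 * max s 0 ^ 2 ≤ (max (z + β * s) 0 - z) ^ 2 := by
  rcases le_total s 0 with hs | hs
  · rw [max_eq_right hs]
    nlinarith [sq_nonneg (max (z + β * s) 0 - z)]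
  · rw [max_eq_left hs, max_eq_left (by positivity)]
    exact le_of_eq (by ring)

theorem two_mul_abs_max_mul_le (hβ : 0 < β) :
    2 * β * |max (z + β * s) 0 * s| ≤
      max (z + β * s) 0 ^ 2 + (max (z + β * s) 0 - z) ^ 2 := by
  rw [← abs_of_pos (show 0 < 2 * β by positivity), ← abs_mul, two_mul_max_mul_eq, abs_le]
  rcases max_cases (z + β * s) 0 with ⟨h, -⟩ | ⟨h, -⟩ <;> rw [h] <;>
    constructor <;> nlinarith [sq_nonneg z, sq_nonneg (2 * (z + β * s) - z), sq_nonneg (z + β * s),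
      sq_nonneg (β * s)]

theorem two_mul_max_mul_sub_le (a c : ℝ) :
    2 * (max a 0 * (c - a)) ≤ max c 0 ^ 2 - max a 0 ^ 2 := by
  rcases max_cases a 0 with ⟨h, ha⟩ | ⟨h, ha⟩ <;> rcases max_cases c 0 with ⟨h', hc⟩ | ⟨h', hc⟩ <;>
    rw [h, h'] <;> nlinarith [sq_nonneg (a - c), sq_nonneg c]

/-- Change of the inequality penalty `([z + β s]₊² - z²) / (2β)` under one dual update. -/
theorem penalty_update_le {β' : ℝ} (hz : 0 ≤ z) (hβ : 0 < β) (hα : 0 ≤ α) (hαβ : α ≤ β)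
    (hββ' : β ≤ β') :
    (max (z + α * max (-z / β) s + β' * s) 0 ^ 2 - (z + α * max (-z / β) s) ^ 2) / (2 * β') ≤
      (max (z + β * s) 0 ^ 2 - z ^ 2) / (2 * β)
        + (β' - β) / 2 * ((max (z + β * s) 0 - z) ^ 2 / β ^ 2) + α * max s 0 ^ 2
        + (z ^ 2 - (z + α * max (-z / β) s) ^ 2
            + α * (max s 0 * (z + (z + α * max (-z / β) s)))) / β' := by
  have hβ' : 0 < β' := hβ.trans_le hββ'
  rcases le_total (-z / β) s with hs | hs
  · rw [max_eq_right hs]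
    have hs' : 0 ≤ z + β * s := by
      rw [div_le_iff₀ hβ] at hs
      linarith
    have hz' : 0 ≤ z + α * s := by
      rcases le_total 0 s with h | h <;> nlinarith
    rw [max_eq_left hs']
    have e1 : ((z + β * s) ^ 2 - z ^ 2) / (2 * β) = z * s + β * s ^ 2 / 2 := by
      field_simp
      ring
    have e2 : (z + β * s - z) ^ 2 / β ^ 2 = s ^ 2 := by
      field_simp
      ring
    rw [e1, e2]
    rcases le_total 0 s with h0 | h0
    · rw [max_eq_left h0, max_eq_left (by positivity)]
      refine le_of_eq ?_
      field_simp
      ring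
    · rw [max_eq_right h0, div_le_iff₀ (by positivity)]
      have e3 : (z * s + β * s ^ 2 / 2 + (β' - β) / 2 * s ^ 2 + α * 0 ^ 2 +
          (z ^ 2 - (z + α * s) ^ 2 + α * (0 * (z + (z + α * s)))) / β') * (2 * β') =
          2 * β' * (z * s) + β' ^ 2 * s ^ 2 + 2 * (z ^ 2 - (z + α * s) ^ 2) := by
        field_simp
        ring
      rw [e3]
      have hαs : α * s ≤ 0 := mul_nonpos_of_nonneg_of_nonpos hα h0
      rcases max_cases (z + α * s + β' * s) 0 with ⟨h, hc⟩ | ⟨h, hc⟩ <;> rw [h]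
      · nlinarith
      · nlinarith [sq_nonneg (β' * s + z)]
  · rw [max_eq_left hs]
    have hs' : z + β * s ≤ 0 := by
      rw [le_div_iff₀ hβ] at hs
      linarith
    have h0 : s ≤ 0 := hs.trans (div_nonpos_of_nonpos_of_nonneg (by linarith) hβ.le)
    have ht : α * (-z / β) ≤ 0 :=
      mul_nonpos_of_nonneg_of_nonpos hα (div_nonpos_of_nonpos_of_nonneg (by linarith) hβ.le)
    have ht' : 0 ≤ z + α * (-z / β) := by
      have : α * (-z / β) = -(α / β * z) := by ring
      have h1 : α / β ≤ 1 := (div_le_one hβ).2 hαβ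
      nlinarith
    have hmax : z + α * (-z / β) + β' * s ≤ 0 := by nlinarith
    rw [max_eq_right hs', max_eq_right h0, max_eq_right hmax, div_le_iff₀ (by positivity)]
    have e3 : ((0 ^ 2 - z ^ 2) / (2 * β) + (β' - β) / 2 * ((0 - z) ^ 2 / β ^ 2) + α * 0 ^ 2 +
        (z ^ 2 - (z + α * (-z / β)) ^ 2 + α * (0 * (z + (z + α * (-z / β))))) / β') * (2 * β') =
        z ^ 2 * ((β' / β - 1) ^ 2 + 1) - 2 * (z + α * (-z / β)) ^ 2 := by
      field_simp
      ring
    rw [e3]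
    nlinarith [mul_nonneg (sq_nonneg z) (sq_nonneg (β' / β - 1))]

end ScalarMultiplier

section DualStep

variable {E G ι : Type*} [NormedAddCommGroup E] [InnerProductSpace ℝ E]
  [NormedAddCommGroup G] [InnerProductSpace ℝ G] [Fintype ι]

theorem two_mul_inner_add_smul_eq (y r : G) (β : ℝ) :
    2 * β * ⟪y + β • r, r⟫ = ‖y + β • r‖ ^ 2 - ‖y‖ ^ 2 + ‖y + β • r - y‖ ^ 2 := by
  rw [add_sub_cancel_left, norm_add_smul_sq, norm_smul, inner_add_left, real_inner_smul_left,
    real_inner_self_eq_norm_sq, mul_pow, Real.norm_eq_abs, sq_abs]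
  ring

theorem inner_add_five (a₁ a₂ a₃ a₄ : E) (u : E) (c : ι → ℝ) (γ : ι → E) :
    ⟪a₁ + a₂ + a₃ + (∑ i, c i • γ i) + a₄, u⟫ =
      ⟪a₁, u⟫ + ⟪a₂, u⟫ + ⟪a₃, u⟫ + (∑ i, c i * ⟪γ i, u⟫) + ⟪a₄, u⟫ := by
  simp only [inner_add_left, sum_inner, real_inner_smul_left]

theorem abs_inner_le_of_norm_le {a u : E} {B D : ℝ} (ha : ‖a‖ ≤ B) (hu : ‖u‖ ≤ D) :
    |⟪a, u⟫| ≤ B * D :=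
  (abs_real_inner_le_norm a u).trans (mul_le_mul ha hu (norm_nonneg _) ((norm_nonneg _).trans ha))

/-- Change of the augmented Lagrangian at a fixed point under one dual update. -/
theorem augmented_lagrangian_update_le {y r : G} {z s : ι → ℝ} {β β' α : ℝ} (hz : ∀ i, 0 ≤ z i)
    (hβ : 0 < β) (hα : 0 ≤ α) (hαβ : α ≤ β) (hββ' : β ≤ β') :
    (‖y + α • r + β' • r‖ ^ 2 - ‖y + α • r‖ ^ 2) / (2 * β')
      + ∑ i, (max (z i + α * max (-z i / β) (s i) + β' * s i) 0 ^ 2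
          - (z i + α * max (-z i / β) (s i)) ^ 2) / (2 * β') ≤
    (‖y + β • r‖ ^ 2 - ‖y‖ ^ 2) / (2 * β)
      + ∑ i, (max (z i + β * s i) 0 ^ 2 - z i ^ 2) / (2 * β)
      + (β' - β) / 2 * ((‖y + β • r - y‖ ^ 2 + ∑ i, (max (z i + β * s i) 0 - z i) ^ 2) / β ^ 2)
      + α * (‖r‖ ^ 2 + ∑ i, max (s i) 0 ^ 2)
      + (∑ i, z i ^ 2 - ∑ i, (z i + α * max (-z i / β) (s i)) ^ 2
          + α * ∑ i, max (s i) 0 * (z i + (z i + α * max (-z i / β) (s i)))) / β' := by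
  have hβ' : 0 < β' := hβ.trans_le hββ'
  have h1 := Finset.sum_le_sum fun i (_ : i ∈ Finset.univ) =>
    penalty_update_le (s := s i) (hz i) hβ hα hαβ hββ'
  simp only [Finset.sum_add_distrib, Finset.sum_sub_distrib, ← Finset.mul_sum, ← Finset.sum_div]
    at h1 ⊢
  have h2 : (‖y + α • r + β' • r‖ ^ 2 - ‖y + α • r‖ ^ 2) / (2 * β') =
      (‖y + β • r‖ ^ 2 - ‖y‖ ^ 2) / (2 * β) + (β' - β) / 2 * (‖y + β • r - y‖ ^ 2 / β ^ 2)
        + α * ‖r‖ ^ 2 := by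
    rw [norm_add_smul_sq (y + α • r), add_sub_cancel_left, norm_add_smul_sq y r β, norm_smul,
      inner_add_left, real_inner_smul_left, real_inner_self_eq_norm_sq, mul_pow, Real.norm_eq_abs,
      sq_abs]
    field_simp
    ring
  rw [h2, add_div _ _ (β ^ 2)]
  linarith

variable [CompleteSpace E] [CompleteSpace G]

/-- Testing approximate stationarity of the proximal augmented Lagrangian subproblem against a
strictly feasible point `x₀` controls the new multipliers. -/
theorem multiplier_step_le {A : E →L[ℝ] G} {b y : G} {x₀ x x' c w v : E} {z γ : ι → ℝ}
    {Γ : ι → E} {β ρ D B r e κ R : ℝ} (hβ : 0 < β) (hρ : 0 < ρ) (hAx₀ : A x₀ = b)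
    (hc : ‖c‖ ≤ B) (hv : ‖v‖ ≤ r) (hw : R * ‖w‖ ≤ ⟪w, x' - x₀⟫)
    (hD₀ : ‖x' - x₀‖ ≤ D) (hD : ‖x' - x‖ ≤ D) (hΓ : ∀ i, γ i + κ ≤ ⟪Γ i, x' - x₀⟫)
    (hres : ‖c + (w + v) + ContinuousLinearMap.adjoint A (y + β • (A x' - b))
      + (∑ i, max (z i + β * γ i) 0 • Γ i) + (2 * ρ) • (x' - x)‖ ≤ e) :
    ‖y + β • (A x' - b)‖ ^ 2 + ∑ i, max (z i + β * γ i) 0 ^ 2 - (‖y‖ ^ 2 + ∑ i, z i ^ 2)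
      + (‖y + β • (A x' - b) - y‖ ^ 2 + ∑ i, (max (z i + β * γ i) 0 - z i) ^ 2)
      + 2 * β * κ * ∑ i, max (z i + β * γ i) 0 + 2 * β * R * ‖w‖
      ≤ 2 * β * (D * (B + r + 2 * ρ * D + e)) := by
  have h1 := abs_le.1 (abs_inner_le_of_norm_le hres hD₀)
  rw [inner_add_five, inner_add_left, ContinuousLinearMap.adjoint_inner_left, map_sub, hAx₀,
    real_inner_smul_left] at h1
  have h2 := abs_le.1 (abs_inner_le_of_norm_le hc hD₀)
  have h3 := abs_le.1 (abs_inner_le_of_norm_le hv hD₀)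
  have h4 := abs_le.1 (abs_inner_le_of_norm_le hD hD₀)
  have h5 := two_mul_inner_add_smul_eq y (A x' - b) β
  have h6 : ∑ i, (max (z i + β * γ i) 0 * γ i + κ * max (z i + β * γ i) 0) ≤
      ∑ i, max (z i + β * γ i) 0 * ⟪Γ i, x' - x₀⟫ := by
    refine Finset.sum_le_sum fun i _ => ?_
    nlinarith [hΓ i, le_max_right (z i + β * γ i) 0]
  rw [Finset.sum_add_distrib, ← Finset.mul_sum] at h6
  have h7 : 2 * β * ∑ i, max (z i + β * γ i) 0 * γ i = ∑ i, max (z i + β * γ i) 0 ^ 2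
      - ∑ i, z i ^ 2 + ∑ i, (max (z i + β * γ i) 0 - z i) ^ 2 := by
    rw [Finset.mul_sum, ← Finset.sum_sub_distrib, ← Finset.sum_add_distrib]
    exact Finset.sum_congr rfl fun i _ => two_mul_max_mul_eq
  have h8 : 2 * ρ * ⟪x' - x, x' - x₀⟫ ≥ -(2 * ρ * (D * D)) := by nlinarith
  have h9 : ⟪y + β • (A x' - b), A x' - b⟫ + ∑ i, max (z i + β * γ i) 0 * γ i
      + κ * ∑ i, max (z i + β * γ i) 0 + R * ‖w‖ ≤ D * (B + r + 2 * ρ * D + e) := by linarith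
  have h10 := mul_le_mul_of_nonneg_left h9 (show 0 ≤ 2 * β by positivity)
  linarith

theorem norm_adjoint_multiplier_le {A : E →L[ℝ] G} {Y : G} {Δ c w v : E} {Z : ι → ℝ}
    {Γ : ι → E} {ρ D B r e L : ℝ} (hρ : 0 < ρ) (hc : ‖c‖ ≤ B) (hv : ‖v‖ ≤ r) (hD : ‖Δ‖ ≤ D)
    (hZ : ∀ i, 0 ≤ Z i) (hΓ : ∀ i, ‖Γ i‖ ≤ L)
    (hres : ‖c + (w + v) + ContinuousLinearMap.adjoint A Y + (∑ i, Z i • Γ i) + (2 * ρ) • Δ‖ ≤ e) :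
    ‖ContinuousLinearMap.adjoint A Y‖ ≤ ‖w‖ + r + B + 2 * ρ * D + e + L * ∑ i, Z i := by
  have hsum : ‖∑ i, Z i • Γ i‖ ≤ L * ∑ i, Z i := by
    rw [Finset.mul_sum]
    refine norm_sum_le_of_le _ fun i _ => ?_
    rw [norm_smul, Real.norm_of_nonneg (hZ i), mul_comm]
    exact mul_le_mul_of_nonneg_right (hΓ i) (hZ i)
  have hΔ : ‖(2 * ρ) • Δ‖ ≤ 2 * ρ * D := by
    rw [norm_smul, Real.norm_of_nonneg (by positivity)]
    exact mul_le_mul_of_nonneg_left hD (by positivity)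
  set T := c + (w + v) + ContinuousLinearMap.adjoint A Y + (∑ i, Z i • Γ i) + (2 * ρ) • Δ
  have hT : ContinuousLinearMap.adjoint A Y =
      T - (2 * ρ) • Δ - (∑ i, Z i • Γ i) - v - w - c := by
    simp only [T]
    abel
  rw [hT]
  have h1 := norm_sub_le (T - (2 * ρ) • Δ - (∑ i, Z i • Γ i) - v - w) c
  have h2 := norm_sub_le (T - (2 * ρ) • Δ - (∑ i, Z i • Γ i) - v) w
  have h3 := norm_sub_le (T - (2 * ρ) • Δ - (∑ i, Z i • Γ i)) v
  have h4 := norm_sub_le (T - (2 * ρ) • Δ) (∑ i, Z i • Γ i)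
  have h5 := norm_sub_le T ((2 * ρ) • Δ)
  linarith

/-- Sufficient decrease of the augmented Lagrangian at an approximate stationary point of the
proximal subproblem. -/
theorem augmented_lagrangian_descent {A : E →L[ℝ] G} {b y : G} {x x' c ζ : E} {z : ι → ℝ}
    {g : ι → E → ℝ} {Γ : ι → E} {β ρ e F H F' H' : ℝ} (hβ : 0 < β)
    (hf : F' + ⟪c, x - x'⟫ - ρ / 2 * ‖x - x'‖ ^ 2 ≤ F) (hh : H' + ⟪ζ, x - x'⟫ ≤ H)
    (hΓ : ∀ i, g i x' + ⟪Γ i, x - x'⟫ ≤ g i x)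
    (hres : ‖c + ζ + ContinuousLinearMap.adjoint A (y + β • (A x' - b))
      + (∑ i, max (z i + β * g i x') 0 • Γ i) + (2 * ρ) • (x' - x)‖ ≤ e) :
    F' + H' + (‖y + β • (A x' - b)‖ ^ 2 - ‖y‖ ^ 2) / (2 * β)
      + ∑ i, (max (z i + β * g i x') 0 ^ 2 - z i ^ 2) / (2 * β)
      + (3 / 2 * ρ * ‖x' - x‖ ^ 2 - e * ‖x' - x‖) ≤
    F + H + (‖y + β • (A x - b)‖ ^ 2 - ‖y‖ ^ 2) / (2 * β)
      + ∑ i, (max (z i + β * g i x) 0 ^ 2 - z i ^ 2) / (2 * β) := by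
  have h1 := abs_le.1 (abs_inner_le_of_norm_le hres (norm_sub_rev x x').le)
  rw [inner_add_five, ContinuousLinearMap.adjoint_inner_left,
    real_inner_smul_left, ← neg_sub x x', inner_neg_left, real_inner_self_eq_norm_sq, norm_neg]
    at h1
  rw [norm_sub_rev x' x]
  have h2 : ⟪y + β • (A x' - b), A (x - x')⟫ ≤
      (‖y + β • (A x - b)‖ ^ 2 - ‖y‖ ^ 2) / (2 * β)
        - (‖y + β • (A x' - b)‖ ^ 2 - ‖y‖ ^ 2) / (2 * β) := by
    rw [← sub_div, le_div_iff₀ (by positivity)]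
    have e1 : y + β • (A x - b) = (y + β • (A x' - b)) + β • A (x - x') := by
      rw [map_sub]
      module
    rw [e1, norm_add_smul_sq]
    nlinarith [mul_nonneg (sq_nonneg β) (sq_nonneg ‖A (x - x')‖)]
  have h3 : ∑ i, max (z i + β * g i x') 0 * ⟪Γ i, x - x'⟫ ≤
      ∑ i, (max (z i + β * g i x) 0 ^ 2 - z i ^ 2) / (2 * β)
        - ∑ i, (max (z i + β * g i x') 0 ^ 2 - z i ^ 2) / (2 * β) := by
    rw [← Finset.sum_sub_distrib]
    refine Finset.sum_le_sum fun i _ => ?_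
    rw [← sub_div, le_div_iff₀ (by positivity)]
    have e1 := two_mul_max_mul_sub_le (z i + β * g i x') (z i + β * g i x)
    have e2 := mul_le_mul_of_nonneg_left (hΓ i)
      (mul_nonneg hβ.le (le_max_right (z i + β * g i x') 0))
    nlinarith
  linarith

end DualStep
section LeastPositiveEigenvalue

variable {E G : Type*} [NormedAddCommGroup E] [InnerProductSpace ℝ E] [CompleteSpace E]
  [NormedAddCommGroup G] [InnerProductSpace ℝ G] [CompleteSpace G]

/-- The positive eigenvalues of `A A†`. -/
def posEigenvalues (A : E →L[ℝ] G) : Set ℝ :=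
  {μ : ℝ | 0 < μ ∧ ∃ w : G, w ≠ 0 ∧ A (ContinuousLinearMap.adjoint A w) = μ • w}

theorem bddBelow_posEigenvalues (A : E →L[ℝ] G) : BddBelow (posEigenvalues A) :=
  ⟨0, fun _ hμ => hμ.1.le⟩

variable [FiniteDimensional ℝ G]

theorem finite_posEigenvalues (A : E →L[ℝ] G) : (posEigenvalues A).Finite := by
  refine (Module.End.finite_hasEigenvalue
    (f := (A.comp (ContinuousLinearMap.adjoint A)).toLinearMap)).subset ?_
  rintro μ ⟨-, w, hw, hwμ⟩
  exact Module.End.hasEigenvalue_of_hasEigenvector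
    (Module.End.hasEigenvector_iff.2 ⟨Module.End.mem_eigenspace_iff.2 hwμ, hw⟩)

theorem exists_orthonormalBasis_adjoint (A : E →L[ℝ] G) :
    ∃ (e : OrthonormalBasis (Fin (Module.finrank ℝ G)) ℝ G)
      (μ : Fin (Module.finrank ℝ G) → ℝ),
      (∀ i, A (ContinuousLinearMap.adjoint A (e i)) = μ i • e i) ∧
      ∀ i, μ i ∈ posEigenvalues A ∨ (μ i = 0 ∧ ∀ w, ⟪e i, A w⟫ = 0) := by
  have hsymm : (A.comp (ContinuousLinearMap.adjoint A)).toLinearMap.IsSymmetric := fun u w => by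
    change ⟪A (ContinuousLinearMap.adjoint A u), w⟫ = ⟪u, A (ContinuousLinearMap.adjoint A w)⟫
    rw [← ContinuousLinearMap.adjoint_inner_right, ContinuousLinearMap.adjoint_inner_left]
  have hT : ∀ i, A (ContinuousLinearMap.adjoint A (hsymm.eigenvectorBasis rfl i)) =
      hsymm.eigenvalues rfl i • hsymm.eigenvectorBasis rfl i := fun i =>
    hsymm.apply_eigenvectorBasis rfl i
  refine ⟨hsymm.eigenvectorBasis rfl, hsymm.eigenvalues rfl, hT, fun i => ?_⟩
  set q := hsymm.eigenvectorBasis rfl i with hq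
  have hqn : ‖q‖ = 1 := (hsymm.eigenvectorBasis rfl).orthonormal.1 i
  have hnorm : ‖ContinuousLinearMap.adjoint A q‖ ^ 2 = hsymm.eigenvalues rfl i := by
    rw [← real_inner_self_eq_norm_sq, ContinuousLinearMap.adjoint_inner_left, hT i,
      real_inner_smul_right, real_inner_self_eq_norm_sq, hqn]
    ring
  rcases (sq_nonneg ‖ContinuousLinearMap.adjoint A q‖).eq_or_lt with h0 | h0
  · right
    refine ⟨by rw [← hnorm, ← h0], fun w => ?_⟩
    have : ContinuousLinearMap.adjoint A q = 0 := by
      simpa using h0.symm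
    rw [← ContinuousLinearMap.adjoint_inner_left, this, inner_zero_left]
  · left
    exact ⟨hnorm ▸ h0, q, by rw [← norm_ne_zero_iff, hqn]; exact one_ne_zero, hT i⟩

theorem sqrt_sInf_posEigenvalues_mul_norm_le (A : E →L[ℝ] G) (w : E) :
    √(sInf (posEigenvalues A)) * ‖A w‖ ≤ ‖ContinuousLinearMap.adjoint A (A w)‖ := by
  have hl : 0 ≤ sInf (posEigenvalues A) := Real.sInf_nonneg fun _ hμ => hμ.1.le
  obtain ⟨e, μ, he, hμ⟩ := exists_orthonormalBasis_adjoint A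
  refine le_of_sq_le_sq ?_ (norm_nonneg _)
  rw [mul_pow, Real.sq_sqrt hl, ← real_inner_self_eq_norm_sq (ContinuousLinearMap.adjoint A (A w)),
    ContinuousLinearMap.adjoint_inner_left, ← e.sum_sq_norm_inner_right (A w), Finset.mul_sum,
    ← e.sum_inner_mul_inner]
  refine Finset.sum_le_sum fun i _ => ?_
  have h1 : ⟪e i, A (ContinuousLinearMap.adjoint A (A w))⟫ = μ i * ⟪e i, A w⟫ := by
    rw [← ContinuousLinearMap.adjoint_inner_left, ContinuousLinearMap.adjoint_inner_right, he i,
      real_inner_smul_left]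
  rw [h1, real_inner_comm (e i), Real.norm_eq_abs, sq_abs]
  rcases hμ i with h | ⟨-, h⟩
  · nlinarith [mul_le_mul_of_nonneg_right (csInf_le (bddBelow_posEigenvalues A) h)
      (sq_nonneg ⟪e i, A w⟫)]
  · simp [h]

theorem apply_eq_zero_of_sInf_posEigenvalues_nonpos {A : E →L[ℝ] G}
    (hA : sInf (posEigenvalues A) ≤ 0) (w : E) : A w = 0 := by
  obtain ⟨e, μ, -, hμ⟩ := exists_orthonormalBasis_adjoint A
  refine InnerProductSpace.ext_inner_left_basis e.toBasis fun i => ?_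
  rcases hμ i with h | ⟨-, h⟩
  · exact absurd (Set.Nonempty.csInf_mem ⟨_, h⟩ (finite_posEigenvalues A)).1 hA.not_gt
  · simpa using h w

end LeastPositiveEigenvalue
section ScalarSequences

theorem inv_mul_log_sq_le {t : ℝ} (ht : 2 ≤ t) :
    1 / ((t + 1) * Real.log (t + 1) ^ 2) ≤ 1 / Real.log t - 1 / Real.log (t + 1) := by
  have h1 : 0 < Real.log t := Real.log_pos (by linarith)
  have h2 : Real.log t ≤ Real.log (t + 1) := Real.log_le_log (by linarith) (by linarith)
  have h3 : 1 / (t + 1) ≤ Real.log (t + 1) - Real.log t := by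
    rw [← Real.log_div (by linarith) (by linarith)]
    have := Real.one_sub_inv_le_log_of_pos (show 0 < (t + 1) / t by positivity)
    refine le_trans (le_of_eq ?_) this
    field_simp
    ring
  rw [div_sub_div _ _ h1.ne' (h1.trans_le h2).ne', one_mul, mul_one, ← div_div]
  calc 1 / (t + 1) / Real.log (t + 1) ^ 2
      ≤ (Real.log (t + 1) - Real.log t) / Real.log (t + 1) ^ 2 := by gcongr
    _ ≤ (Real.log (t + 1) - Real.log t) / (Real.log t * Real.log (t + 1)) := by
      apply div_le_div_of_nonneg_left (by linarith) (mul_pos h1 (h1.trans_le h2))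
      nlinarith

/-- The sequence `1, 1 / (2 log² 2), 1 / (3 log² 3), …` is dominated by the decrements of a
nonnegative sequence bounded by `5`. -/
theorem exists_inv_mul_log_sq_le_sub : ∃ V : ℕ → ℝ, (∀ k, 0 ≤ V k) ∧ (∀ k, V k ≤ 5) ∧
    1 ≤ V 0 - V 1 ∧
    ∀ k : ℕ, 1 ≤ k → 1 / (((k : ℝ) + 1) * Real.log (k + 1) ^ 2) ≤ V k - V (k + 1) := by
  have hl := Real.log_two_gt_d9
  have hl0 : 0 < 2 * Real.log 2 ^ 2 := mul_pos two_pos (pow_pos (by linarith) 2)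
  have h1 : 1 / Real.log 2 ≤ 3 / 2 := by
    rw [div_le_iff₀ (by linarith)]
    linarith
  have h2 : 1 / (2 * Real.log 2 ^ 2) ≤ 9 / 8 := by
    rw [div_le_iff₀ hl0]
    nlinarith
  have h3 : 0 < 1 / Real.log 2 := one_div_pos.2 (by linarith)
  have h4 : 0 < 1 / (2 * Real.log 2 ^ 2) := one_div_pos.2 hl0
  let V : ℕ → ℝ := fun k => match k with
    | 0 => 1 / Real.log 2 + 1 / (2 * Real.log 2 ^ 2) + 1
    | 1 => 1 / Real.log 2 + 1 / (2 * Real.log 2 ^ 2)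
    | k + 2 => 1 / Real.log ((k + 2 : ℕ) : ℝ)
  have hV2 : ∀ k : ℕ, V (k + 2) = 1 / Real.log ((k : ℝ) + 2) := fun k => by simp [V]
  have hlog : ∀ k : ℕ, Real.log 2 ≤ Real.log ((k : ℝ) + 2) := fun k =>
    Real.log_le_log (by norm_num) (by linarith [(Nat.cast_nonneg k : (0 : ℝ) ≤ k)])
  refine ⟨V, fun k => ?_, fun k => ?_, ?_, fun k hk => ?_⟩
  · match k with
    | 0 => simp only [V]; linarith
    | 1 => simp only [V]; linarith
    | k + 2 =>
      rw [hV2]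
      exact one_div_nonneg.2 (by linarith [hlog k])
  · match k with
    | 0 => simp only [V]; linarith
    | 1 => simp only [V]; linarith
    | k + 2 =>
      rw [hV2]
      have := one_div_le_one_div_of_le (by linarith) (hlog k)
      linarith
  · simp only [V]
    linarith
  · match k, hk with
    | 1, _ =>
      rw [hV2 0]
      simp only [V]
      norm_num
    | k + 2, _ =>
      rw [hV2, show k + 2 + 1 = (k + 1) + 2 from rfl, hV2]
      have := inv_mul_log_sq_le (t := (k : ℝ) + 2)
        (by linarith [(Nat.cast_nonneg k : (0 : ℝ) ≤ k)])
      push_cast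
      convert this using 4
      ring

theorem nsmul_le_of_descent {W V δ : ℕ → ℝ} {a c d : ℝ} {N K : ℕ} (hc : 0 ≤ c)
    (hW : ∀ k, W (k + 1) + δ (k + 1) ≤ W k + c * (V k - V (k + 1)))
    (hWa : ∀ k, W k ≤ a) (hWb : ∀ k, -a ≤ W k)
    (hV : ∀ k, 0 ≤ V k) (hV5 : ∀ k, V k ≤ 5)
    (hδ : ∀ k, N < k → k ≤ N + K → d ≤ δ k) : K * d ≤ 2 * a + 5 * c := by
  have key : ∀ j : ℕ, j ≤ K → W (N + j) + c * V (N + j) + j * d ≤ W N + c * V N := by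
    intro j
    induction j with
    | zero => simp
    | succ j ih =>
      intro hj
      have h1 := ih (by omega)
      have h2 := hW (N + j)
      have h3 := hδ (N + j + 1) (by omega) (by omega)
      push_cast
      rw [← add_assoc]
      linarith
  have h1 := key K le_rfl
  have h2 := mul_nonneg hc (hV (N + K))
  have h3 := mul_le_mul_of_nonneg_left (hV5 N) hc
  linarith [hWa N, hWb (N + K)]

theorem le_and_le_of_convex_update {P P' t : ℕ → ℝ} {M : ℝ} (ht0 : ∀ k, 0 ≤ t k)
    (ht1 : ∀ k, t k ≤ 1) (hP : ∀ k, P (k + 1) ≤ (1 - t k) * P k + t k * P' k)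
    (hP' : ∀ k, P' k ≤ max (P k) M) (h0 : P 0 ≤ M) (k : ℕ) : P k ≤ M ∧ P' k ≤ M := by
  have hk : P k ≤ M := by
    induction k with
    | zero => exact h0
    | succ k ih =>
      have h1 : P' k ≤ M := (hP' k).trans (max_le ih le_rfl)
      nlinarith [hP k, mul_le_mul_of_nonneg_left h1 (ht0 k),
        mul_le_mul_of_nonneg_left ih (sub_nonneg.2 (ht1 k))]
  exact ⟨hk, (hP' k).trans (max_le hk le_rfl)⟩

theorem le_max_sq_of_step {p q c κ C : ℝ} (hq : 0 ≤ q) (hc : 0 < c) (hκ : 0 < κ)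
    (h : q - p + c * (κ * √q) ≤ c * C) : q ≤ max p ((C / κ) ^ 2) := by
  rcases le_or_gt q p with hqp | hqp
  · exact le_max_of_le_left hqp
  · refine le_max_of_le_right ?_
    have h1 : κ * √q ≤ C := le_of_mul_le_mul_left (by linarith) hc
    have h2 : √q ≤ C / κ := by
      rw [le_div_iff₀ hκ]
      linarith
    calc q = √q ^ 2 := (Real.sq_sqrt hq).symm
      _ ≤ (C / κ) ^ 2 := pow_le_pow_left₀ (Real.sqrt_nonneg q) h2 2

end ScalarSequences
section CappedSteps

theorem rpow_inv_sixteen_pow {t : ℝ} (ht : 0 ≤ t) : (t ^ (1 / 16 : ℝ)) ^ 16 = t := by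
  rw [← Real.rpow_natCast, ← Real.rpow_mul ht]
  norm_num

theorem rpow_inv_four_eq {t : ℝ} (ht : 0 ≤ t) : t ^ (1 / 4 : ℝ) = (t ^ (1 / 16 : ℝ)) ^ 4 := by
  rw [← Real.rpow_natCast, ← Real.rpow_mul ht]
  norm_num

theorem six_le_log {t : ℝ} (ht : 404 ≤ t) : 6 ≤ Real.log t := by
  rw [Real.le_log_iff_exp_le (by linarith)]
  have h1 : Real.exp 6 = Real.exp 1 ^ 6 := by
    rw [← Real.exp_nat_mul]
    norm_num
  rw [h1]
  calc Real.exp 1 ^ 6 ≤ 2.7182818286 ^ 6 :=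
        pow_le_pow_left₀ (Real.exp_pos 1).le Real.exp_one_lt_d9.le 6
    _ ≤ t := le_trans (by norm_num) ht

theorem log_mul_rpow_le {t T : ℝ} (ht : 404 ≤ t) (hT : t ≤ T) :
    Real.log T * t ^ (1 / 16 : ℝ) ≤ 8 / 3 * T ^ (1 / 16 : ℝ) * Real.log t := by
  have h6 := six_le_log ht
  have ht0 : 0 < t := by linarith
  have hT0 : 0 < T := by linarith
  set a := t ^ (1 / 16 : ℝ) with ha
  set c := T ^ (1 / 16 : ℝ) with hc
  have ha0 : 0 < a := Real.rpow_pos_of_pos ht0 _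
  have hc0 : 0 < c := Real.rpow_pos_of_pos hT0 _
  have hac : a ≤ c := Real.rpow_le_rpow ht0.le hT (by norm_num)
  have hlogT : Real.log T = 16 * Real.log c := by
    rw [hc, Real.log_rpow hT0]
    ring
  have hlogt : Real.log t = 16 * Real.log a := by
    rw [ha, Real.log_rpow ht0]
    ring
  have h1 : Real.log c - Real.log a ≤ c / a - 1 := by
    rw [← Real.log_div hc0.ne' ha0.ne']
    exact Real.log_le_sub_one_of_pos (by positivity)
  have h2 : (Real.log T - Real.log t) * a ≤ 16 * (c - a) := by
    have := mul_le_mul_of_nonneg_right h1 ha0.le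
    rw [sub_mul (c / a), div_mul_cancel₀ _ ha0.ne'] at this
    rw [hlogT, hlogt]
    linarith
  nlinarith [mul_le_mul_of_nonneg_right h6 (show 0 ≤ 8 / 3 * c - a by linarith)]

/-- Comparison of the capped weights `min 1 (V / (t log² t))` at two scales. -/
theorem min_div_log_sq_le {t T V : ℝ} (hV : 0 ≤ V) (ht : 404 ≤ t) (hT : t ≤ T) :
    min 1 (V / (t * Real.log t ^ 2)) * (t ^ (1 / 16 : ℝ)) ^ 18 ≤
      64 / 9 * (T ^ (1 / 16 : ℝ)) ^ 18 * min 1 (V / (T * Real.log T ^ 2)) := by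
  have h6 := six_le_log ht
  have h6' := six_le_log (ht.trans hT)
  have hlog := log_mul_rpow_le ht hT
  have ht0 : 0 < t := by linarith
  have hT0 : 0 < T := by linarith
  have ha := rpow_inv_sixteen_pow ht0.le
  have hc := rpow_inv_sixteen_pow hT0.le
  have hac : t ^ (1 / 16 : ℝ) ≤ T ^ (1 / 16 : ℝ) := Real.rpow_le_rpow ht0.le hT (by norm_num)
  have ha0 : 0 < t ^ (1 / 16 : ℝ) := Real.rpow_pos_of_pos ht0 _
  set a := t ^ (1 / 16 : ℝ)
  set c := T ^ (1 / 16 : ℝ)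
  have hc0 : 0 < c := ha0.trans_le hac
  rw [mul_min_of_nonneg _ _ (by positivity), min_mul_of_nonneg _ _ (by positivity)]
  refine min_le_min ?_ ?_
  · have := pow_le_pow_left₀ ha0.le hac 18
    have : 0 ≤ c ^ 18 := by positivity
    linarith
  · have h1 : (Real.log T * a) ^ 2 ≤ (8 / 3 * c * Real.log t) ^ 2 :=
      pow_le_pow_left₀ (by positivity) hlog 2
    have hlt : 0 < Real.log t := by linarith
    have hlT : 0 < Real.log T := by linarith
    rw [div_mul_eq_mul_div, mul_div_assoc', div_le_div_iff₀ (by positivity) (by positivity)]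
    have e1 : V * a ^ 18 * (T * Real.log T ^ 2) = V * a ^ 16 * T * (Real.log T * a) ^ 2 := by ring
    have e2 : 64 / 9 * c ^ 18 * V * (t * Real.log t ^ 2) =
        V * t * c ^ 16 * (8 / 3 * c * Real.log t) ^ 2 := by ring
    rw [e1, e2, ha, hc, mul_comm V t, mul_comm t V]
    exact mul_le_mul_of_nonneg_left h1 (by positivity)

theorem one_le_rpow_sub_rpow (k : ℕ) :
    1 ≤ 8 * (((k : ℝ) + 1) ^ (1 / 16 : ℝ)) ^ 14 *
      ((((k : ℝ) + 1) ^ (1 / 16 : ℝ)) ^ 2 - ((k : ℝ) ^ (1 / 16 : ℝ)) ^ 2) := by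
  have hk : (0 : ℝ) ≤ k := Nat.cast_nonneg k
  have ha := rpow_inv_sixteen_pow (show (0 : ℝ) ≤ k + 1 by linarith)
  have hc := rpow_inv_sixteen_pow hk
  have hca : (k : ℝ) ^ (1 / 16 : ℝ) ≤ ((k : ℝ) + 1) ^ (1 / 16 : ℝ) :=
    Real.rpow_le_rpow hk (by linarith) (by norm_num)
  have hc0 : 0 ≤ (k : ℝ) ^ (1 / 16 : ℝ) := Real.rpow_nonneg hk _
  set a := ((k : ℝ) + 1) ^ (1 / 16 : ℝ)
  set c := (k : ℝ) ^ (1 / 16 : ℝ)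
  have h2 : c ^ 2 ≤ a ^ 2 := pow_le_pow_left₀ hc0 hca 2
  have h3 : a ^ 16 - c ^ 16 = 1 := by
    rw [ha, hc]
    ring
  have hpow : ∀ i j : ℕ, i + j = 7 → (a ^ 2) ^ i * (c ^ 2) ^ j ≤ (a ^ 2) ^ 7 := fun i j hij => by
    rw [← hij, pow_add]
    exact mul_le_mul_of_nonneg_left (pow_le_pow_left₀ (sq_nonneg c) h2 j) (by positivity)
  have h4 : a ^ 16 - c ^ 16 = (a ^ 2 - c ^ 2) * ((a ^ 2) ^ 7 * (c ^ 2) ^ 0 + (a ^ 2) ^ 6 * (c ^ 2) ^ 1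
      + (a ^ 2) ^ 5 * (c ^ 2) ^ 2 + (a ^ 2) ^ 4 * (c ^ 2) ^ 3 + (a ^ 2) ^ 3 * (c ^ 2) ^ 4
      + (a ^ 2) ^ 2 * (c ^ 2) ^ 5 + (a ^ 2) ^ 1 * (c ^ 2) ^ 6 + (a ^ 2) ^ 0 * (c ^ 2) ^ 7) := by ring
  have h5 : a ^ 16 - c ^ 16 ≤ (a ^ 2 - c ^ 2) * (8 * (a ^ 2) ^ 7) := by
    rw [h4]
    refine mul_le_mul_of_nonneg_left ?_ (sub_nonneg.2 h2)
    linarith [hpow 7 0 rfl, hpow 6 1 rfl, hpow 5 2 rfl, hpow 4 3 rfl, hpow 3 4 rfl, hpow 2 5 rfl,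
      hpow 1 6 rfl, hpow 0 7 rfl]
  calc (1 : ℝ) ≤ (a ^ 2 - c ^ 2) * (8 * (a ^ 2) ^ 7) := by linarith
    _ = 8 * a ^ 14 * (a ^ 2 - c ^ 2) := by ring

/-- A sequence that may grow slowly at first but decreases fast on the last dyadic scale. -/
theorem le_add_of_capped_steps {P s : ℕ → ℝ} {θ V : ℝ} {K : ℕ} (hθ : 0 ≤ θ) (hV : 0 ≤ V)
    (hs0 : ∀ k, 0 ≤ s k) (hs1 : ∀ k, s k ≤ 1)
    (hs : ∀ k : ℕ, 1 ≤ k → s k = min 1 (V / (((k : ℝ) + 1) * Real.log (k + 1) ^ 2)))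
    (h1 : ∀ k < K, P (k + 1) ≤ P k + s k * min (θ * ((k : ℝ) + 1) ^ (1 / 4 : ℝ)) (1 / 24))
    (h2 : ∀ k < K, K ≤ 600 * (k + 1) → P (k + 1) ≤ P k)
    (h3 : ∀ k < K, K ≤ 2 * (k + 1) →
      P (k + 1) ≤ P k - 79 * (s k * (θ * ((k : ℝ) + 1) ^ (1 / 4 : ℝ)))) :
    P K ≤ P 0 + 17 := by
  have hstart : ∀ k ≤ K, P k ≤ P 0 + k * (1 / 24) := by
    intro k
    induction k with
    | zero => simp
    | succ k ih =>
      intro hk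
      have e1 := h1 k (by omega)
      have e2 : s k * min (θ * ((k : ℝ) + 1) ^ (1 / 4 : ℝ)) (1 / 24) ≤ 1 * (1 / 24) :=
        mul_le_mul (hs1 k) (min_le_right _ _) (le_min (by positivity) (by norm_num)) zero_le_one
      push_cast
      linarith [ih (by omega)]
  have hmid : ∀ k ≤ K, (K - 1) / 600 ≤ k → P k ≤ P ((K - 1) / 600) := by
    intro k hk hn
    induction k, hn using Nat.le_induction with
    | base => exact le_rfl
    | succ k hn ih => exact (h2 k (by omega) (by omega)).trans (ih (by omega))
  rcases le_or_gt ((K - 1) / 600) 403 with hn | hn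
  · have e1 := hmid K le_rfl (by omega)
    have e2 := hstart ((K - 1) / 600) (by omega)
    have e3 : (((K - 1) / 600 : ℕ) : ℝ) ≤ 403 := by exact_mod_cast hn
    linarith
  set n := (K - 1) / 600 with hn_def
  set R := (K : ℝ) ^ (1 / 16 : ℝ) with hR
  have hK0 : (0 : ℝ) ≤ K := Nat.cast_nonneg K
  have hR0 : 0 ≤ R := Real.rpow_nonneg hK0 _
  have hR16 : R ^ 16 = K := rpow_inv_sixteen_pow hK0
  set S := min 1 (V / ((K : ℝ) * Real.log K ^ 2)) with hS
  have hS0 : 0 ≤ S := le_min zero_le_one (by positivity)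
  have hgrow : ∀ k ≤ K, 403 ≤ k → P k ≤ P 403 +
      8 * (64 / 9 * R ^ 18 * S * θ) * ((k : ℝ) ^ (1 / 16 : ℝ)) ^ 2 := by
    intro k hk h403
    induction k, h403 using Nat.le_induction with
    | base =>
      have : 0 ≤ 8 * (64 / 9 * R ^ 18 * S * θ) * (((403 : ℕ) : ℝ) ^ (1 / 16 : ℝ)) ^ 2 := by
        positivity
      linarith
    | succ k h403 ih =>
      have hkr : (403 : ℝ) ≤ k := by exact_mod_cast h403
      have hkK : (k : ℝ) + 1 ≤ K := by exact_mod_cast hk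
      have e1 := h1 k (by omega)
      have e2 := ih (by omega)
      have e3 := min_div_log_sq_le hV (show 404 ≤ (k : ℝ) + 1 by linarith) hkK
      rw [← hs k (by omega)] at e3
      have e4 := one_le_rpow_sub_rpow k
      rw [rpow_inv_four_eq (by positivity)] at e1
      have ha0 : 0 < ((k : ℝ) + 1) ^ (1 / 16 : ℝ) := by positivity
      push_cast
      set a := ((k : ℝ) + 1) ^ (1 / 16 : ℝ)
      set c := (k : ℝ) ^ (1 / 16 : ℝ)
      have e5 : s k * min (θ * a ^ 4) (1 / 24) ≤ s k * (θ * a ^ 4) :=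
        mul_le_mul_of_nonneg_left (min_le_left _ _) (hs0 k)
      have e6 : s k * (θ * a ^ 4) ≤ 8 * (64 / 9 * R ^ 18 * S * θ) * (a ^ 2 - c ^ 2) := by
        refine le_of_mul_le_mul_right ?_ (show 0 < a ^ 14 by positivity)
        have g1 := mul_le_mul_of_nonneg_left e3 hθ
        have g2 := mul_le_mul_of_nonneg_left e4 (show 0 ≤ 64 / 9 * R ^ 18 * S * θ by positivity)
        calc s k * (θ * a ^ 4) * a ^ 14 = θ * (s k * a ^ 18) := by ring
          _ ≤ θ * (64 / 9 * R ^ 18 * S) := g1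
          _ = 64 / 9 * R ^ 18 * S * θ * 1 := by ring
          _ ≤ _ := g2
          _ = _ := by ring
      linarith
  have hdrop : ∀ k ≤ K, (K - 1) / 2 ≤ k → P k ≤ P ((K - 1) / 2) -
      ((k : ℝ) - ((K - 1) / 2 : ℕ)) * (66 * (S * (θ * R ^ 4))) := by
    intro k hk hh
    induction k, hh using Nat.le_induction with
    | base => simp
    | succ k hh ih =>
      have e1 := h3 k (by omega) (by omega)
      have e2 := ih (by omega)
      rw [rpow_inv_four_eq (by positivity)] at e1
      have hkK : (k : ℝ) + 1 ≤ K := by exact_mod_cast hk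
      have hkK' : (K : ℝ) ≤ 2 * (k + 1) := by
        have : K ≤ 2 * (k + 1) := by omega
        exact_mod_cast this
      have hk1 : (1 : ℝ) ≤ k := by
        have : 1 ≤ k := by omega
        exact_mod_cast this
      have e3 : S ≤ s k := by
        rw [hs k (by omega)]
        have hl : 0 < Real.log ((k : ℝ) + 1) := Real.log_pos (by linarith)
        refine min_le_min le_rfl (div_le_div_of_nonneg_left hV (by positivity) ?_)
        gcongr
      have ha16 := rpow_inv_sixteen_pow (show (0 : ℝ) ≤ k + 1 by positivity)
      have ha0 : 0 ≤ ((k : ℝ) + 1) ^ (1 / 16 : ℝ) := by positivity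
      set a := ((k : ℝ) + 1) ^ (1 / 16 : ℝ)
      have e4 : 66 * R ^ 4 ≤ 79 * a ^ 4 := by
        by_contra! hcon
        have g1 := pow_lt_pow_left₀ hcon (by positivity) (show 4 ≠ 0 by norm_num)
        have g2 : (79 * a ^ 4) ^ 4 = 38950081 * a ^ 16 := by ring
        have g3 : (66 * R ^ 4) ^ 4 = 18974736 * R ^ 16 := by ring
        rw [g2, g3, ha16, hR16] at g1
        linarith
      have e5 : 66 * (S * (θ * R ^ 4)) ≤ 79 * (s k * (θ * a ^ 4)) := by
        calc 66 * (S * (θ * R ^ 4)) = S * θ * (66 * R ^ 4) := by ring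
          _ ≤ s k * θ * (79 * a ^ 4) := by
            refine mul_le_mul (mul_le_mul_of_nonneg_right e3 hθ) e4 (by positivity) ?_
            exact mul_nonneg (hs0 k) hθ
          _ = _ := by ring
      push_cast
      linarith
  have f1 := hstart 403 (by omega)
  have f2 := hgrow n (by omega) (by omega)
  have f3 := hmid ((K - 1) / 2) (by omega) (by omega)
  have f4 := hdrop K le_rfl (by omega)
  have f5 : (K : ℝ) / 2 ≤ (K : ℝ) - ((K - 1) / 2 : ℕ) := by
    have : 2 * ((K - 1) / 2) ≤ K := by omega
    have : 2 * (((K - 1) / 2 : ℕ) : ℝ) ≤ K := by exact_mod_cast this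
    linarith
  have f6 : 2 * ((n : ℝ) ^ (1 / 16 : ℝ)) ^ 2 ≤ R ^ 2 := by
    by_contra! hcon
    have g1 := pow_lt_pow_left₀ hcon (by positivity) (show 8 ≠ 0 by norm_num)
    have g2 : (2 * ((n : ℝ) ^ (1 / 16 : ℝ)) ^ 2) ^ 8 = 256 * ((n : ℝ) ^ (1 / 16 : ℝ)) ^ 16 := by ring
    have g3 : (R ^ 2) ^ 8 = R ^ 16 := by ring
    rw [g2, g3, hR16, rpow_inv_sixteen_pow (Nat.cast_nonneg n)] at g1
    have : 256 * n ≤ K := by omega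
    have : 256 * (n : ℝ) ≤ K := by exact_mod_cast this
    linarith
  have f7 := mul_le_mul_of_nonneg_left f6 (show 0 ≤ 4 * (64 / 9 * R ^ 18 * S * θ) by positivity)
  have f8 := mul_le_mul_of_nonneg_right f5 (show 0 ≤ 66 * (S * (θ * R ^ 4)) by positivity)
  have f9 : (K : ℝ) / 2 * (66 * (S * (θ * R ^ 4))) = 33 * (S * θ * R ^ 20) := by
    rw [← hR16]
    ring
  have f10 : 4 * (64 / 9 * R ^ 18 * S * θ) * R ^ 2 = 256 / 9 * (S * θ * R ^ 20) := by ring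
  have f11 : 0 ≤ S * θ * R ^ 20 := by positivity
  push_cast at f1
  linarith

end CappedSteps
section FeasibleStep

theorem three_hundred_twenty_mul_sub_le {C : ℝ} (hC : 2 ≤ C) : 320 * (C - 2) ≤ C ^ 6 := by
  have h1 : 12 * (C - 2) + 8 ≤ C ^ 3 := by
    nlinarith [mul_nonneg (sq_nonneg (C - 2)) (show 0 ≤ C + 4 by linarith)]
  have h2 := pow_le_pow_left₀ (show 0 ≤ 12 * (C - 2) + 8 by linarith) h1 2
  nlinarith [sq_nonneg (C - 2)]

/-- Once `x` is large compared with `C`, a capped dual step decreases the multiplier by a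
multiple of the inexactness `θ`. -/
theorem capped_decrease {C Q gmin β x u v θ : ℝ} (hC : 2 ≤ C) (hQ : 0 ≤ Q) (hβ : 0 < β)
    (hg : 0 < gmin) (hgC : 4 * Q ≤ gmin * (C - 2)) (hθ0 : 0 ≤ θ) (hθ : θ ^ 2 ≤ Q * β)
    (hx : 7 / 8 * C ^ 2 ≤ x) (hxu : x ≤ u) (hv : 0 < v) :
    79 * (min 1 (v / x) * θ) ≤ min 1 (v / u) * (u ^ 2 + 2 * β * (gmin * x - Q) - θ) := by
  have hx0 : 0 < x := lt_of_lt_of_le (by positivity) hx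
  have hu0 : 0 < u := hx0.trans_le hxu
  have h1 : 28 * Q ≤ 7 / 8 * (gmin * C ^ 2) := by nlinarith [sq_nonneg (C - 4)]
  have h2 : 7 / 8 * (gmin * C ^ 2) ≤ gmin * x := by nlinarith
  have hB : 0 ≤ 2 * β * (gmin * x - Q) := by
    have : 0 ≤ gmin * x - Q := by linarith
    positivity
  have h3 : 1045 * Q ≤ C ^ 4 * (gmin * x - Q) := by
    have g1 := mul_le_mul_of_nonneg_left (three_hundred_twenty_mul_sub_le hC) hg.le
    have g2 : 27 / 28 * (7 / 8 * (gmin * C ^ 2)) ≤ gmin * x - Q := by linarith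
    have g3 := mul_le_mul_of_nonneg_left g2 (show 0 ≤ C ^ 4 by positivity)
    nlinarith
  have h4 : (40 * θ) ^ 2 ≤ x ^ 2 * (2 * β * (gmin * x - Q)) := by
    have g1 : 49 / 64 * C ^ 4 ≤ x ^ 2 := by
      have := pow_le_pow_left₀ (by positivity) hx 2
      linarith [show (7 / 8 * C ^ 2) ^ 2 = 49 / 64 * C ^ 4 by ring]
    have g2 := mul_le_mul_of_nonneg_right g1 hB
    have g3 := mul_le_mul_of_nonneg_left h3 (show 0 ≤ 49 / 32 * β by positivity)
    nlinarith [mul_nonneg hQ hβ.le]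
  set B := 2 * β * (gmin * x - Q)
  have h5 : 40 * θ ≤ x * √B := by
    refine le_of_sq_le_sq ?_ (by positivity)
    rwa [mul_pow x, Real.sq_sqrt hB]
  have h6 : 2 * (u * √B) ≤ u ^ 2 + B := by
    nlinarith [sq_nonneg (u - √B), Real.sq_sqrt hB]
  have h7 : min 1 (v / x) * x ≤ min 1 (v / u) * u := by
    rw [min_mul_of_nonneg _ _ hx0.le, min_mul_of_nonneg _ _ hu0.le, div_mul_cancel₀ _ hx0.ne',
      div_mul_cancel₀ _ hu0.ne', one_mul, one_mul]
    exact min_le_min hxu le_rfl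
  have h8 : min 1 (v / u) ≤ min 1 (v / x) :=
    min_le_min le_rfl (div_le_div_of_nonneg_left hv.le hx0 hxu)
  have ht0 : 0 ≤ min 1 (v / u) := le_min zero_le_one (by positivity)
  have hs0 : 0 ≤ min 1 (v / x) := le_min zero_le_one (by positivity)
  nlinarith [mul_le_mul_of_nonneg_left h6 ht0, mul_le_mul_of_nonneg_right h7 (Real.sqrt_nonneg B),
    mul_le_mul_of_nonneg_left h5 hs0, mul_le_mul_of_nonneg_right h8 hθ0]

/-- Without equality constraints, the dual recursion cannot stay infeasible up to step `K`. -/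
theorem exists_feasible_step {N Pb p β v t e : ℕ → ℝ} {β₀ v₀ ε gmin Q D ρ C : ℝ} {K : ℕ}
    (hβ₀ : 0 < β₀) (hv₀ : 0 < v₀) (hε : 0 < ε) (hg : 0 < gmin) (hQ : 0 ≤ Q) (hD : 0 ≤ D)
    (hρ : 0 < ρ) (hC : 2 ≤ C) (hgC : 4 * Q ≤ gmin * (C - 2)) (hQD : 2 * ρ * D ^ 2 ≤ Q)
    (hβ : ∀ k : ℕ, β k = β₀ * √(k + 1)) (hv0 : ∀ k, 0 < v k)
    (hv : ∀ k : ℕ, 1 ≤ k → v k = v₀ / (√(k + 1) * Real.log (k + 1) ^ 2))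
    (he : ∀ k, e k ≤ √(ρ / (2 * β k)))
    (hK : 25 / 16 * C ^ 4 ≤ β₀ ^ 2 * ε ^ 2 * K)
    (hN0 : N 0 ≤ C ^ 2) (hPb : ∀ k, (β k * p k) ^ 2 ≤ Pb k)
    (ht : ∀ k, 0 < p k → t k = min 1 (v k / (β k * p k)))
    (hN : ∀ k, N (k + 1) ≤ (1 - t k) * N k + t k * Pb k)
    (hstep : ∀ k, Pb k - N k + (β k * p k) ^ 2 + 2 * β k * gmin * √(Pb k) ≤
      2 * β k * (Q + D * e k)) :
    ∃ k ≤ K, p k ≤ ε := by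
  by_contra! hinf
  have hβ0 : ∀ k, 0 < β k := fun k => by
    rw [hβ]
    positivity
  let x : ℕ → ℝ := fun k => β k * ε
  let θ : ℕ → ℝ := fun k => D * √(2 * ρ * β₀) * ((k : ℝ) + 1) ^ (1 / 4 : ℝ)
  have hx0 : ∀ k, 0 < x k := fun k => mul_pos (hβ0 k) hε
  have hx2 : ∀ k, x k ^ 2 = β₀ ^ 2 * ε ^ 2 * (k + 1) := fun k => by
    simp only [x, hβ]
    rw [mul_pow, mul_pow, Real.sq_sqrt (by positivity)]
    ring
  have hxu : ∀ k ≤ K, x k ≤ β k * p k := fun k hk =>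
    mul_le_mul_of_nonneg_left (hinf k hk).le (hβ0 k).le
  have hθ0 : ∀ k, 0 ≤ θ k := fun k => by positivity
  have hθ : ∀ k, θ k = D * √(2 * ρ * β k) := fun k => by
    simp only [θ]
    rw [hβ, ← mul_assoc, Real.sqrt_mul (by positivity) (√((k : ℝ) + 1)), mul_assoc]
    congr 2
    rw [Real.sqrt_eq_rpow, Real.sqrt_eq_rpow, ← Real.rpow_mul (by positivity)]
    norm_num
  have hθ2 : ∀ k, θ k ^ 2 ≤ Q * β k := fun k => by
    have := hβ0 k
    rw [hθ, mul_pow, Real.sq_sqrt (by positivity)]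
    nlinarith
  have heθ : ∀ k, 2 * β k * (D * e k) ≤ θ k := fun k => by
    have hb := hβ0 k
    have h1 : 2 * β k * √(ρ / (2 * β k)) = √(2 * ρ * β k) := by
      rw [← Real.sqrt_sq (show 0 ≤ 2 * β k by positivity), ← Real.sqrt_mul (by positivity),
        Real.sqrt_sq (show 0 ≤ 2 * β k by positivity)]
      congr 1
      field_simp
    rw [hθ, ← h1]
    nlinarith [mul_le_mul_of_nonneg_left (he k) (show 0 ≤ 2 * β k * D by positivity)]
  have hC2 : 4 ≤ C ^ 2 := by nlinarith
  have hC4 : 4 * C ^ 2 ≤ C ^ 4 := by nlinarith [mul_nonneg (sq_nonneg C) (sub_nonneg.2 hC2)]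
  have hPb0 : ∀ k, 0 ≤ Pb k := fun k => (sq_nonneg _).trans (hPb k)
  have hquad : ∀ a : ℝ, a - 6 * a ^ 2 ≤ 1 / 24 := fun a => by nlinarith [sq_nonneg (12 * a - 1)]
  have hgap : ∀ k, C ^ 2 ≤ Pb k → Pb k - N k ≤ -(β k * p k) ^ 2 + (θ k - 6 * θ k ^ 2) := by
    intro k hk
    have h1 : C ≤ √(Pb k) := Real.le_sqrt_of_sq_le hk
    have h2 : 4 * Q ≤ gmin * √(Pb k) := by nlinarith
    have hb := hβ0 k
    nlinarith [hstep k, heθ k, hθ2 k]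
  have hu0 : ∀ k ≤ K, 0 < p k := fun k hk => hε.trans (hinf k hk)
  have hts : ∀ k ≤ K, t k ≤ min 1 (v k / x k) := fun k hk => by
    rw [ht k (hu0 k hk)]
    exact min_le_min le_rfl (div_le_div_of_nonneg_left (hv0 k).le (hx0 k) (hxu k hk))
  have ht0 : ∀ k ≤ K, 0 ≤ t k := fun k hk => by
    rw [ht k (hu0 k hk)]
    exact le_min zero_le_one (div_nonneg (hv0 k).le (mul_nonneg (hβ0 k).le (hu0 k hk).le))
  have ht1 : ∀ k ≤ K, t k ≤ 1 := fun k hk => (hts k hk).trans (min_le_left _ _)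
  have hu2 : ∀ k ≤ K, x k ^ 2 ≤ (β k * p k) ^ 2 := fun k hk =>
    pow_le_pow_left₀ (hx0 k).le (hxu k hk) 2
  have hlow : ∀ k ≤ K, 25 / 32 * C ^ 4 ≤ x k ^ 2 → 2 * x k ^ 2 - 1 / 24 ≤ N k := by
    intro k hk hxk
    have h1 := hgap k (by linarith [hPb k, hu2 k hk])
    linarith [hquad (θ k), hPb k, hu2 k hk]
  have hstepP : ∀ k ≤ K, ∀ r : ℝ, 0 ≤ r →
      (C ^ 2 ≤ Pb k → Pb k - N k ≤ r) → max (N (k + 1)) (C ^ 2) ≤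
        max (N k) (C ^ 2) + min 1 (v k / x k) * r := by
    intro k hk r hr h
    have hs0 : 0 ≤ min 1 (v k / x k) := (ht0 k hk).trans (hts k hk)
    have h0 : 0 ≤ min 1 (v k / x k) * r := mul_nonneg hs0 hr
    refine max_le ?_ (by linarith [le_max_right (N k) (C ^ 2)])
    rcases le_total (C ^ 2) (Pb k) with hc | hc
    · have h2 := mul_le_mul_of_nonneg_left (h hc) (ht0 k hk)
      have h3 := mul_le_mul_of_nonneg_right (hts k hk) hr
      linarith [hN k, le_max_left (N k) (C ^ 2)]
    · have h2 := mul_le_mul_of_nonneg_left (hc.trans (le_max_right (N k) (C ^ 2))) (ht0 k hk)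
      have h3 := mul_le_mul_of_nonneg_left (le_max_left (N k) (C ^ 2))
        (sub_nonneg.2 (ht1 k hk))
      linarith [hN k]
  have hxK : ∀ a : ℝ, 0 < a → ∀ k : ℕ, (K : ℝ) ≤ a * (k + 1) → 25 / 16 * C ^ 4 ≤ a * x k ^ 2 := by
    intro a ha k hk
    rw [hx2]
    have := mul_le_mul_of_nonneg_left hk (show 0 ≤ β₀ ^ 2 * ε ^ 2 by positivity)
    linarith
  have hmain := le_add_of_capped_steps (P := fun k => max (N k) (C ^ 2))
    (s := fun k => min 1 (v k / x k)) (θ := D * √(2 * ρ * β₀)) (V := v₀ / (β₀ * ε)) (K := K)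
    (by positivity) (by positivity)
    (fun k => le_min zero_le_one (div_nonneg (hv0 k).le (hx0 k).le))
    (fun k => min_le_left _ _)
    (fun k hk => by
      simp only [x]
      rw [hv k hk, hβ]
      congr 1
      have h1 : (0 : ℝ) < k := by exact_mod_cast hk
      have h2 : 0 < Real.log ((k : ℝ) + 1) := Real.log_pos (by linarith)
      have h3 := Real.sq_sqrt (show 0 ≤ (k : ℝ) + 1 by linarith)
      rw [div_div, div_div]
      congr 1
      linear_combination (Real.log ((k : ℝ) + 1) ^ 2 * β₀ * ε) * h3)
    (fun k hk => by
      refine hstepP k hk.le _ (le_min (hθ0 k) (by norm_num)) fun hc => ?_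
      have h1 := hgap k hc
      refine le_min ?_ ?_
      · linarith [sq_nonneg (β k * p k), sq_nonneg (θ k)]
      · linarith [sq_nonneg (β k * p k), hquad (θ k)])
    (fun k hk hk' => by
      have h := hstepP k hk.le 0 le_rfl fun hc => by
        have h1 := hgap k hc
        have h2 := hxK 600 (by norm_num) k (by exact_mod_cast hk')
        linarith [hu2 k hk.le, hquad (θ k)]
      linarith)
    (fun k hk hk' => by
      have h1 := hxK 2 (by norm_num) k (by exact_mod_cast hk')
      have h2 := hxK 2 (by norm_num) (k + 1) (by
        have : K ≤ 2 * (k + 1 + 1) := by omega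
        exact_mod_cast this)
      have h3 := hlow k hk.le (by linarith)
      have h4 := hlow (k + 1) hk (by linarith)
      rw [max_eq_left (by linarith), max_eq_left (by linarith)]
      have h5 : 7 / 8 * C ^ 2 ≤ x k := by
        refine le_of_sq_le_sq ?_ (hx0 k).le
        nlinarith [show (7 / 8 * C ^ 2) ^ 2 = 49 / 64 * C ^ 4 by ring]
      have h6 := capped_decrease hC hQ (hβ0 k) hg hgC (hθ0 k) (hθ2 k) h5 (hxu k hk.le) (hv0 k)
      rw [← ht k (hu0 k hk.le)] at h6
      have h7 : β k * p k ≤ √(Pb k) := Real.le_sqrt_of_sq_le (hPb k)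
      have h8 : gmin * x k ≤ gmin * √(Pb k) :=
        mul_le_mul_of_nonneg_left ((hxu k hk.le).trans h7) hg.le
      have h9 : Pb k - N k ≤ -((β k * p k) ^ 2 + 2 * β k * (gmin * x k - Q) - θ k) := by
        have := mul_le_mul_of_nonneg_left h8 (show 0 ≤ 2 * β k from by linarith [hβ0 k])
        linarith [hstep k, heθ k]
      have h10 := mul_le_mul_of_nonneg_left h9 (ht0 k hk.le)
      change N (k + 1) ≤ N k - 79 * (min 1 (v k / x k) * θ k)
      linarith [hN k])
  have h1 := hxK 1 one_pos K (by linarith)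
  have h2 := hlow K le_rfl (by linarith)
  simp only [max_eq_right hN0] at hmain
  linarith [le_max_left (N K) (C ^ 2)]

end FeasibleStep
section DualRun

section

variable {E ι : Type*} {g : ι → E → ℝ} {x : ℕ → E} {z : ℕ → ι → ℝ} {β : ℕ → ℝ}

/-- The trial inequality multiplier `[z + β g(x⁺)]₊`. -/
def trialZ (g : ι → E → ℝ) (x : ℕ → E) (z : ℕ → ι → ℝ) (β : ℕ → ℝ) (k : ℕ) (i : ι) : ℝ :=
  max (z k i + β k * g i (x (k + 1))) 0

theorem trialZ_nonneg (k : ℕ) (i : ι) : 0 ≤ trialZ g x z β k i := le_max_right _ _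

end

section

variable {G ι : Type*} [NormedAddCommGroup G] [Fintype ι]

/-- Squared norm of a multiplier pair. -/
def dualSq (y : G) (z : ι → ℝ) : ℝ := ‖y‖ ^ 2 + ∑ i, z i ^ 2

theorem dualSq_nonneg (y : G) (z : ι → ℝ) : 0 ≤ dualSq y z :=
  add_nonneg (sq_nonneg _) (Finset.sum_nonneg fun _ _ => sq_nonneg _)

theorem sum_sq_le_dualSq (y : G) (z : ι → ℝ) : ∑ i, z i ^ 2 ≤ dualSq y z :=
  le_add_of_nonneg_left (sq_nonneg _)

theorem sqrt_dualSq_le {z : ι → ℝ} (y : G) (hz : ∀ i, 0 ≤ z i) :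
    √(dualSq y z) ≤ ‖y‖ + ∑ i, z i := by
  have h0 : 0 ≤ ∑ i, z i := Finset.sum_nonneg fun i _ => hz i
  rw [Real.sqrt_le_left (by positivity), dualSq]
  have h1 : ∑ i, z i ^ 2 ≤ (∑ i, z i) ^ 2 := by
    rw [sq, Finset.sum_mul]
    refine Finset.sum_le_sum fun i _ => ?_
    rw [sq]
    exact mul_le_mul_of_nonneg_left
      (Finset.single_le_sum (fun j _ => hz j) (Finset.mem_univ i)) (hz i)
  nlinarith [mul_nonneg (norm_nonneg y) h0]

end

variable {E G ι : Type*} [NormedAddCommGroup E] [InnerProductSpace ℝ E]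
  [NormedAddCommGroup G] [InnerProductSpace ℝ G] [Fintype ι]

theorem dualSq_sub_le (y y' : G) (z z' : ι → ℝ) :
    dualSq (y - y') (fun i => z i - z' i) ≤ 2 * dualSq y z + 2 * dualSq y' z' := by
  have h1 : ‖y - y'‖ ^ 2 ≤ 2 * ‖y‖ ^ 2 + 2 * ‖y'‖ ^ 2 := by
    nlinarith [parallelogram_law_with_norm ℝ y y', sq_nonneg ‖y + y'‖]
  have h2 : ∑ i, (z i - z' i) ^ 2 ≤ 2 * ∑ i, z i ^ 2 + 2 * ∑ i, z' i ^ 2 := by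
    rw [Finset.mul_sum, Finset.mul_sum, ← Finset.sum_add_distrib]
    exact Finset.sum_le_sum fun i _ => by nlinarith [sq_nonneg (z i + z' i)]
  unfold dualSq
  linarith

theorem sum_mul_add_le {s z z' : ι → ℝ} {p M : ℝ} (hp : 0 ≤ p) (hM : 0 ≤ M)
    (hs : ∑ i, s i ^ 2 ≤ p ^ 2) (hz : ∑ i, z i ^ 2 ≤ M ^ 2) (hz' : ∑ i, z' i ^ 2 ≤ M ^ 2) :
    ∑ i, s i * (z i + z' i) ≤ 2 * M * p := by
  have h1 := Finset.sum_mul_sq_le_sq_mul_sq Finset.univ s (fun i => z i + z' i)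
  have h2 : ∑ i, (z i + z' i) ^ 2 ≤ (2 * M) ^ 2 := by
    have : ∑ i, (z i + z' i) ^ 2 ≤ 2 * ∑ i, z i ^ 2 + 2 * ∑ i, z' i ^ 2 := by
      rw [Finset.mul_sum, Finset.mul_sum, ← Finset.sum_add_distrib]
      exact Finset.sum_le_sum fun i _ => by nlinarith [sq_nonneg (z i - z' i)]
    linarith
  refine le_of_sq_le_sq ?_ (by positivity)
  calc (∑ i, s i * (z i + z' i)) ^ 2 ≤ p ^ 2 * (2 * M) ^ 2 :=
        h1.trans (mul_le_mul hs h2 (Finset.sum_nonneg fun i _ => sq_nonneg _) (sq_nonneg p))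
    _ = (2 * M * p) ^ 2 := by ring

/-- The trial equality multiplier `y + β (A x⁺ - b)`. -/
def trialY (A : E →L[ℝ] G) (b : G) (x : ℕ → E) (y : ℕ → G) (β : ℕ → ℝ) (k : ℕ) : G :=
  y k + β k • (A (x (k + 1)) - b)

/-- The multiplier part of a run of DPALM along primal points `x`. -/
structure IsDualRun (A : E →L[ℝ] G) (b : G) (g : ι → E → ℝ) (x : ℕ → E) (y : ℕ → G)
    (z : ℕ → ι → ℝ) (β v α p : ℕ → ℝ) : Prop where
  β_pos : ∀ k, 0 < β k
  v_pos : ∀ k, 0 < v k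
  p_eq : ∀ k, p k = √(‖A (x (k + 1)) - b‖ ^ 2 + ∑ i, max (g i (x (k + 1))) 0 ^ 2)
  α_eq : ∀ k, α k = if p k = 0 then β k else min (β k) (v k / p k)
  y_succ : ∀ k, y (k + 1) = y k + α k • (A (x (k + 1)) - b)
  z_succ : ∀ k i, z (k + 1) i = z k i + α k * max (-(z k i) / β k) (g i (x (k + 1)))
  z_zero : ∀ i, 0 ≤ z 0 i

namespace IsDualRun

variable {A : E →L[ℝ] G} {b : G} {g : ι → E → ℝ} {x : ℕ → E} {y : ℕ → G} {z : ℕ → ι → ℝ}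
  {β v α p : ℕ → ℝ}

theorem p_nonneg (h : IsDualRun A b g x y z β v α p) (k : ℕ) : 0 ≤ p k := by
  rw [h.p_eq]
  exact Real.sqrt_nonneg _

theorem p_sq (h : IsDualRun A b g x y z β v α p) (k : ℕ) :
    p k ^ 2 = ‖A (x (k + 1)) - b‖ ^ 2 + ∑ i, max (g i (x (k + 1))) 0 ^ 2 := by
  rw [h.p_eq, Real.sq_sqrt (add_nonneg (sq_nonneg _) (Finset.sum_nonneg fun i _ => sq_nonneg _))]

theorem α_nonneg (h : IsDualRun A b g x y z β v α p) (k : ℕ) : 0 ≤ α k := by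
  rw [h.α_eq]
  split_ifs
  · exact (h.β_pos k).le
  · exact le_min (h.β_pos k).le (div_nonneg (h.v_pos k).le (h.p_nonneg k))

theorem α_le (h : IsDualRun A b g x y z β v α p) (k : ℕ) : α k ≤ β k := by
  rw [h.α_eq]
  split_ifs
  · exact le_rfl
  · exact min_le_left _ _

theorem α_mul_p_le (h : IsDualRun A b g x y z β v α p) (k : ℕ) : α k * p k ≤ v k := by
  rw [h.α_eq]
  split_ifs with h0
  · rw [h0, mul_zero]
    exact (h.v_pos k).le
  · exact (le_div_iff₀ ((h.p_nonneg k).lt_of_ne' h0)).1 (min_le_right _ _)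

theorem α_div_β_eq (h : IsDualRun A b g x y z β v α p) (k : ℕ) (hp : 0 < p k) :
    α k / β k = min 1 (v k / (β k * p k)) := by
  rw [h.α_eq, if_neg hp.ne', ← min_div_div_right (h.β_pos k).le, div_self (h.β_pos k).ne', div_div,
    mul_comm (p k)]

theorem α_div_β_nonneg (h : IsDualRun A b g x y z β v α p) (k : ℕ) : 0 ≤ α k / β k :=
  div_nonneg (h.α_nonneg k) (h.β_pos k).le

theorem α_div_β_le_one (h : IsDualRun A b g x y z β v α p) (k : ℕ) : α k / β k ≤ 1 :=
  (div_le_one (h.β_pos k)).2 (h.α_le k)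

theorem z_succ_eq (h : IsDualRun A b g x y z β v α p) (k : ℕ) (i : ι) :
    z (k + 1) i = (1 - α k / β k) * z k i + α k / β k * trialZ g x z β k i := by
  rw [h.z_succ, max_neg_div_eq (h.β_pos k), trialZ]
  ring

theorem y_succ_eq (h : IsDualRun A b g x y z β v α p) (k : ℕ) :
    y (k + 1) = (1 - α k / β k) • y k + (α k / β k) • trialY A b x y β k := by
  have h0 := (h.β_pos k).ne'
  rw [h.y_succ, trialY, smul_add, smul_smul, div_mul_cancel₀ _ h0]
  module

theorem z_nonneg (h : IsDualRun A b g x y z β v α p) (k : ℕ) (i : ι) : 0 ≤ z k i := by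
  induction k with
  | zero => exact h.z_zero i
  | succ k ih =>
    rw [h.z_succ_eq]
    exact add_nonneg (mul_nonneg (sub_nonneg.2 (h.α_div_β_le_one k)) ih)
      (mul_nonneg (h.α_div_β_nonneg k) (trialZ_nonneg k i))

theorem exists_apply_eq_y (h : IsDualRun A b g x y z β v α p) (hy : ∃ w, A w = y 0)
    (hb : ∃ w, A w = b) (k : ℕ) : ∃ w, A w = y k := by
  obtain ⟨u, rfl⟩ := hb
  induction k with
  | zero => exact hy
  | succ k ih =>
    obtain ⟨w, hw⟩ := ih
    exact ⟨w + α k • (x (k + 1) - u), by rw [h.y_succ, ← hw, map_add, map_smul, map_sub]⟩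

theorem exists_apply_eq_trialY (h : IsDualRun A b g x y z β v α p) (hy : ∃ w, A w = y 0)
    (hb : ∃ w, A w = b) (k : ℕ) : ∃ w, A w = trialY A b x y β k := by
  obtain ⟨w, hw⟩ := h.exists_apply_eq_y hy hb k
  obtain ⟨u, rfl⟩ := hb
  exact ⟨w + β k • (x (k + 1) - u), by rw [trialY, ← hw, map_add, map_smul, map_sub]⟩

theorem dualSq_succ_le (h : IsDualRun A b g x y z β v α p) (k : ℕ) :
    dualSq (y (k + 1)) (z (k + 1)) ≤ (1 - α k / β k) * dualSq (y k) (z k)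
      + α k / β k * dualSq (trialY A b x y β k) (trialZ g x z β k) := by
  have ht0 := h.α_div_β_nonneg k
  have ht1 := h.α_div_β_le_one k
  have h1 : ‖y (k + 1)‖ ^ 2 ≤ (1 - α k / β k) * ‖y k‖ ^ 2
      + α k / β k * ‖trialY A b x y β k‖ ^ 2 := by
    rw [h.y_succ_eq, norm_add_smul_sq, norm_smul, real_inner_smul_left,
      Real.norm_of_nonneg (sub_nonneg.2 ht1)]
    nlinarith [norm_sub_sq_real (y k) (trialY A b x y β k),
      mul_nonneg (mul_nonneg ht0 (sub_nonneg.2 ht1))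
        (sq_nonneg ‖y k - trialY A b x y β k‖)]
  have h2 : ∑ i, z (k + 1) i ^ 2 ≤ (1 - α k / β k) * ∑ i, z k i ^ 2
      + α k / β k * ∑ i, trialZ g x z β k i ^ 2 := by
    rw [Finset.mul_sum, Finset.mul_sum, ← Finset.sum_add_distrib]
    refine Finset.sum_le_sum fun i _ => ?_
    rw [h.z_succ_eq]
    nlinarith [mul_nonneg (mul_nonneg ht0 (sub_nonneg.2 ht1))
        (sq_nonneg (z k i - trialZ g x z β k i))]
  unfold dualSq
  linarith

theorem sq_β_mul_p_le (h : IsDualRun A b g x y z β v α p) (k : ℕ) :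
    (β k * p k) ^ 2 ≤ dualSq (trialY A b x y β k - y k) (fun i => trialZ g x z β k i - z k i) := by
  rw [mul_pow, h.p_sq, mul_add, Finset.mul_sum, dualSq, trialY, add_sub_cancel_left, norm_smul,
    mul_pow, Real.norm_eq_abs, sq_abs]
  gcongr with i
  exact sq_mul_max_sq_le (h.z_nonneg k i) (h.β_pos k)

theorem p_le_of_dualSq_le (h : IsDualRun A b g x y z β v α p) {M : ℝ} (hM : 0 ≤ M) (k : ℕ)
    (hP : dualSq (y k) (z k) ≤ M ^ 2)
    (hP' : dualSq (trialY A b x y β k) (trialZ g x z β k) ≤ M ^ 2) : β k * p k ≤ 2 * M := by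
  refine le_of_sq_le_sq ?_ (by positivity)
  linarith [h.sq_β_mul_p_le k, dualSq_sub_le (trialY A b x y β k) (y k) (trialZ g x z β k) (z k)]

theorem two_mul_sum_abs_le (h : IsDualRun A b g x y z β v α p) {M : ℝ} (k : ℕ)
    (hP : dualSq (y k) (z k) ≤ M ^ 2)
    (hP' : dualSq (trialY A b x y β k) (trialZ g x z β k) ≤ M ^ 2) :
    2 * β k * ∑ i, |trialZ g x z β k i * g i (x (k + 1))| ≤ 5 * M ^ 2 := by
  have h1 : 2 * β k * ∑ i, |trialZ g x z β k i * g i (x (k + 1))| ≤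
      ∑ i, trialZ g x z β k i ^ 2 + ∑ i, (trialZ g x z β k i - z k i) ^ 2 := by
    rw [Finset.mul_sum, ← Finset.sum_add_distrib]
    exact Finset.sum_le_sum fun i _ => two_mul_abs_max_mul_le (h.β_pos k)
  have h2 := dualSq_sub_le (trialY A b x y β k) (y k) (trialZ g x z β k) (z k)
  have h3 := sum_sq_le_dualSq (trialY A b x y β k) (trialZ g x z β k)
  have h4 := sum_sq_le_dualSq (trialY A b x y β k - y k) (fun i => trialZ g x z β k i - z k i)
  linarith

end IsDualRun

end DualRun
section Bounds

variable {E G ι : Type*} [NormedAddCommGroup E] [InnerProductSpace ℝ E]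
  [NormedAddCommGroup G] [InnerProductSpace ℝ G] [Fintype ι]

theorem infDist_frontier_pos {F : Type*} [NormedAddCommGroup F] [NormedSpace ℝ F] [Nontrivial F]
    {X : Set F} {u : F} (hX : IsCompact X) (hu : u ∈ interior X) :
    0 < infDist u (frontier X) := by
  have : NoncompactSpace F := NormedSpace.noncompactSpace ℝ F
  have hne : (frontier X).Nonempty := by
    rw [Set.nonempty_iff_ne_empty, Ne, frontier_eq_empty_iff, not_or]
    exact ⟨(Set.nonempty_of_mem (interior_subset hu)).ne_empty, hX.ne_univ⟩
  exact (isClosed_frontier.notMem_iff_infDist_pos hne).1 fun h => h.2 hu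

theorem le_mul_sqrt_mul_of_sq_div_le {a s ε : ℝ} {k : ℕ} (hs : 0 < s) (hε : 0 < ε)
    (h : a ^ 2 / (s ^ 2 * ε ^ 2) ≤ k) : a ≤ s * √(k + 1) * ε := by
  refine le_of_sq_le_sq ?_ (by positivity)
  rw [div_le_iff₀ (by positivity)] at h
  rw [mul_pow, mul_pow, Real.sq_sqrt (by positivity)]
  nlinarith [mul_pos (pow_pos hs 2) (pow_pos hε 2)]

namespace IsDualRun

variable {A : E →L[ℝ] G} {b : G} {g : ι → E → ℝ} {x : ℕ → E} {y : ℕ → G} {z : ℕ → ι → ℝ}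
  {β v α p : ℕ → ℝ}

theorem dualSq_le_sq (h : IsDualRun A b g x y z β v α p) {M C κ : ℝ} (hκ : 0 < κ)
    (hM : 0 ≤ M) (hC : 0 ≤ C) (hCM : C ≤ κ * M) (h0 : √(dualSq (y 0) (z 0)) ≤ M)
    (hstep : ∀ k, dualSq (trialY A b x y β k) (trialZ g x z β k) - dualSq (y k) (z k)
      + 2 * β k * (κ * √(dualSq (trialY A b x y β k) (trialZ g x z β k))) ≤ 2 * β k * C) (k : ℕ) :
    dualSq (y k) (z k) ≤ M ^ 2 ∧ dualSq (trialY A b x y β k) (trialZ g x z β k) ≤ M ^ 2 := by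
  refine le_and_le_of_convex_update (P := fun k => dualSq (y k) (z k))
    (P' := fun k => dualSq (trialY A b x y β k) (trialZ g x z β k)) h.α_div_β_nonneg
    h.α_div_β_le_one h.dualSq_succ_le (fun k => ?_) ((Real.sqrt_le_left hM).1 h0) k
  refine (le_max_sq_of_step (dualSq_nonneg _ _) (mul_pos two_pos (h.β_pos k)) hκ (hstep k)).trans ?_
  refine max_le_max le_rfl (pow_le_pow_left₀ (div_nonneg hC hκ.le) ?_ 2)
  rwa [div_le_iff₀' hκ]

/-- The multiplier step without equality constraints. -/
theorem dualSq_step_of_eq_zero (h : IsDualRun A b g x y z β v α p) {c κ R s : ℝ}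
    (hκ : 0 < κ) (hR : 0 ≤ R) (k : ℕ) (hY : trialY A b x y β k = 0)
    (hkey : dualSq (trialY A b x y β k) (trialZ g x z β k) - dualSq (y k) (z k)
      + s + 2 * β k * κ * ∑ i, trialZ g x z β k i + 2 * β k * R ≤ 2 * β k * c) :
    dualSq (trialY A b x y β k) (trialZ g x z β k) - dualSq (y k) (z k) + s
      + 2 * β k * κ * √(dualSq (trialY A b x y β k) (trialZ g x z β k)) ≤ 2 * β k * c := by
  have h1 := sqrt_dualSq_le (trialY A b x y β k) (z := trialZ g x z β k) fun i => trialZ_nonneg k i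
  rw [hY, norm_zero, zero_add, ← hY] at h1
  have hb := h.β_pos k
  have h2 := mul_le_mul_of_nonneg_left h1 (by positivity : 0 ≤ 2 * β k * κ)
  have h3 : 0 ≤ 2 * β k * R := by positivity
  linarith

theorem sq_β_mul_p_le_of_eq (h : IsDualRun A b g x y z β v α p) (k : ℕ)
    (hA : A (x (k + 1)) = b) :
    (β k * p k) ^ 2 ≤ dualSq (trialY A b x y β k) (trialZ g x z β k) := by
  rw [mul_pow, h.p_sq, hA, sub_self, norm_zero, zero_pow two_ne_zero, zero_add, Finset.mul_sum]
  refine le_trans (Finset.sum_le_sum fun i _ => ?_) (sum_sq_le_dualSq _ _)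
  rw [← mul_pow]
  have hb := h.β_pos k
  refine pow_le_pow_left₀ (by positivity) ?_ 2
  rw [mul_max_of_nonneg _ _ hb.le, mul_zero]
  exact max_le_max (le_add_of_nonneg_left (h.z_nonneg k i)) le_rfl

/-- The augmented Lagrangian at `x⁺`, with `Φ` as objective. -/
def meritValue (Φ : E → ℝ) (A : E →L[ℝ] G) (b : G) (g : ι → E → ℝ) (x : ℕ → E) (y : ℕ → G)
    (z : ℕ → ι → ℝ) (β : ℕ → ℝ) (k : ℕ) : ℝ :=
  Φ (x (k + 1)) + (‖trialY A b x y β k‖ ^ 2 - ‖y k‖ ^ 2) / (2 * β k)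
    + ∑ i, (trialZ g x z β k i ^ 2 - z k i ^ 2) / (2 * β k)

theorem meritValue_eq (Φ : E → ℝ) (k : ℕ) : meritValue Φ A b g x y z β k = Φ (x (k + 1))
    + (dualSq (trialY A b x y β k) (trialZ g x z β k) - dualSq (y k) (z k)) / (2 * β k) := by
  simp only [meritValue, dualSq, ← Finset.sum_div, Finset.sum_sub_distrib]
  ring

theorem meritValue_succ_add_le (h : IsDualRun A b g x y z β v α p) {Φ : E → ℝ} {M δ : ℝ}
    (hM : 0 ≤ M) (k : ℕ) (hβ : β k ≤ β (k + 1)) (hβ' : β (k + 1) ≤ 2 * β k)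
    (hP : dualSq (y k) (z k) ≤ M ^ 2) (hP₁ : dualSq (y (k + 1)) (z (k + 1)) ≤ M ^ 2)
    (hP' : dualSq (trialY A b x y β k) (trialZ g x z β k) ≤ M ^ 2)
    (hdesc : meritValue Φ A b g x y z β (k + 1) + δ ≤ Φ (x (k + 1))
      + (‖y (k + 1) + β (k + 1) • (A (x (k + 1)) - b)‖ ^ 2 - ‖y (k + 1)‖ ^ 2) / (2 * β (k + 1))
      + ∑ i, (max (z (k + 1) i + β (k + 1) * g i (x (k + 1))) 0 ^ 2 - z (k + 1) i ^ 2)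
        / (2 * β (k + 1))) :
    meritValue Φ A b g x y z β (k + 1) + 4 * M ^ 2 / β (k + 1)
        + (∑ i, z (k + 1) i ^ 2) / β (k + 1) + δ ≤
      meritValue Φ A b g x y z β k + 4 * M ^ 2 / β k + (∑ i, z k i ^ 2) / β k
        + 4 * M * (v k / β k) := by
  have hb := h.β_pos k
  have hb' := h.β_pos (k + 1)
  have hα := h.α_nonneg k
  have hp := h.p_nonneg k
  have hupd := augmented_lagrangian_update_le (y := y k) (r := A (x (k + 1)) - b)
    (s := fun i => g i (x (k + 1))) (h.z_nonneg k) hb hα (h.α_le k) hβ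
  simp only [← h.y_succ, ← h.z_succ, ← h.p_sq] at hupd
  have hsq : (β (k + 1) - β k) / 2 * ((‖y k + β k • (A (x (k + 1)) - b) - y k‖ ^ 2
      + ∑ i, (max (z k i + β k * g i (x (k + 1))) 0 - z k i) ^ 2) / β k ^ 2) ≤
      4 * M ^ 2 / β k - 4 * M ^ 2 / β (k + 1) := by
    have h1 := dualSq_sub_le (trialY A b x y β k) (y k) (trialZ g x z β k) (z k)
    have h2 : dualSq (trialY A b x y β k - y k) (fun i => trialZ g x z β k i - z k i) ≤
      4 * M ^ 2 := by linarith
    calc _ ≤ (β (k + 1) - β k) / 2 * (4 * M ^ 2 / β k ^ 2) := by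
          refine mul_le_mul_of_nonneg_left ?_ (by linarith)
          exact div_le_div_of_nonneg_right h2 (by positivity)
      _ = 4 * M ^ 2 * (β (k + 1) - β k) / (β k * (2 * β k)) := by field_simp
      _ ≤ 4 * M ^ 2 * (β (k + 1) - β k) / (β k * β (k + 1)) := by
          have : 0 ≤ β (k + 1) - β k := sub_nonneg.2 hβ
          gcongr
      _ = _ := by field_simp
  have hvβ : p k ≤ 2 * M / β k := (le_div_iff₀' hb).2 (h.p_le_of_dualSq_le hM k hP hP')
  have hfeas : α k * p k ^ 2 ≤ 2 * M * (v k / β k) := calc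
    α k * p k ^ 2 = α k * p k * p k := by ring
    _ ≤ v k * (2 * M / β k) := mul_le_mul (h.α_mul_p_le k) hvβ hp (h.v_pos k).le
    _ = 2 * M * (v k / β k) := by ring
  have hcross : α k * ∑ i, max (g i (x (k + 1))) 0 * (z k i + z (k + 1) i) ≤ 2 * M * v k := by
    have h1 : ∑ i, max (g i (x (k + 1))) 0 * (z k i + z (k + 1) i) ≤ 2 * M * p k := by
      refine sum_mul_add_le hp hM ?_ ((sum_sq_le_dualSq _ _).trans hP)
        ((sum_sq_le_dualSq _ _).trans hP₁)
      rw [h.p_sq]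
      exact le_add_of_nonneg_left (sq_nonneg _)
    nlinarith [mul_le_mul_of_nonneg_left h1 hα,
      mul_le_mul_of_nonneg_left (h.α_mul_p_le k) hM]
  have hlast : (∑ i, z k i ^ 2 - ∑ i, z (k + 1) i ^ 2
      + α k * ∑ i, max (g i (x (k + 1))) 0 * (z k i + z (k + 1) i)) / β (k + 1) ≤
      (∑ i, z k i ^ 2) / β k - (∑ i, z (k + 1) i ^ 2) / β (k + 1) + 2 * M * (v k / β k) := by
    have h1 : (∑ i, z k i ^ 2) / β (k + 1) ≤ (∑ i, z k i ^ 2) / β k :=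
      div_le_div_of_nonneg_left (Finset.sum_nonneg fun i _ => sq_nonneg _) hb hβ
    have h2 : (α k * ∑ i, max (g i (x (k + 1))) 0 * (z k i + z (k + 1) i)) / β (k + 1) ≤
        2 * M * (v k / β k) := by
      have := (h.v_pos k).le
      calc _ ≤ 2 * M * v k / β (k + 1) := div_le_div_of_nonneg_right hcross hb'.le
        _ ≤ 2 * M * v k / β k := div_le_div_of_nonneg_left (by positivity) hb hβ
        _ = _ := by ring
    rw [add_div, sub_div]
    linarith
  have hm : meritValue Φ A b g x y z β k = Φ (x (k + 1))
      + (‖y k + β k • (A (x (k + 1)) - b)‖ ^ 2 - ‖y k‖ ^ 2) / (2 * β k)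
      + ∑ i, (max (z k i + β k * g i (x (k + 1))) 0 ^ 2 - z k i ^ 2) / (2 * β k) := rfl
  linarith

/-- A uniform decrease `d` of the augmented Lagrangian over `K` consecutive iterations is bounded
by its initial oscillation. -/
theorem nsmul_le_of_merit_descent (h : IsDualRun A b g x y z β v α p) {Φ : E → ℝ} {δ : ℕ → ℝ}
    {M B β₀ v₀ d : ℝ} {N K : ℕ} (hM : 0 ≤ M) (hβ₀ : 0 < β₀) (hv₀ : 0 < v₀)
    (hβ : ∀ k : ℕ, β k = β₀ * √(k + 1)) (hv0 : v 0 = v₀)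
    (hv : ∀ k : ℕ, 1 ≤ k → v k = v₀ / (√(k + 1) * Real.log (k + 1) ^ 2))
    (hP : ∀ k, dualSq (y k) (z k) ≤ M ^ 2 ∧
      dualSq (trialY A b x y β k) (trialZ g x z β k) ≤ M ^ 2)
    (hΦ : ∀ k, |Φ (x (k + 1))| ≤ B)
    (hdesc : ∀ k, meritValue Φ A b g x y z β (k + 1) + δ (k + 1) ≤ Φ (x (k + 1))
      + (‖y (k + 1) + β (k + 1) • (A (x (k + 1)) - b)‖ ^ 2 - ‖y (k + 1)‖ ^ 2) / (2 * β (k + 1))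
      + ∑ i, (max (z (k + 1) i + β (k + 1) * g i (x (k + 1))) 0 ^ 2 - z (k + 1) i ^ 2)
        / (2 * β (k + 1)))
    (hδ : ∀ k, N < k → k ≤ N + K → d ≤ δ k) :
    K * d ≤ 2 * B + 11 * M ^ 2 / β₀ + 20 * M * (v₀ / β₀) := by
  obtain ⟨V, hV, hV5, hV0, hVs⟩ := exists_inv_mul_log_sq_le_sub
  have hvβ : ∀ k, v k / β k ≤ v₀ / β₀ * (V k - V (k + 1)) := fun k => by
    rcases k.eq_zero_or_pos with rfl | hk
    · rw [hv0, hβ]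
      simpa using le_mul_of_one_le_right (by positivity : 0 ≤ v₀ / β₀) hV0
    · refine le_trans (le_of_eq ?_) (mul_le_mul_of_nonneg_left (hVs k hk) (by positivity))
      have hs : √((k : ℝ) + 1) * √((k : ℝ) + 1) = k + 1 := Real.mul_self_sqrt (by positivity)
      rw [hv k hk, hβ, div_div, div_mul_div_comm, mul_one]
      congr 1
      linear_combination β₀ * Real.log (k + 1) ^ 2 * hs
  have hβle : ∀ k, β₀ ≤ β k := fun k => by
    rw [hβ]
    exact le_mul_of_one_le_right hβ₀.le (Real.one_le_sqrt.2 (by simp))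
  have hβ1 : ∀ k, β k ≤ β (k + 1) := fun k => by
    rw [hβ, hβ]
    push_cast
    gcongr
    simp
  have hβ2 : ∀ k, β (k + 1) ≤ 2 * β k := fun k => by
    rw [hβ, hβ, mul_left_comm]
    gcongr
    rw [Real.sqrt_le_left (by positivity), mul_pow, Real.sq_sqrt (by positivity)]
    push_cast
    linarith [k.cast_nonneg (α := ℝ)]
  have hbd : ∀ k, |meritValue Φ A b g x y z β k| ≤ B + M ^ 2 / (2 * β₀) := fun k => by
    rw [meritValue_eq]
    refine (abs_add_le _ _).trans (add_le_add (hΦ k) ?_)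
    have hk := h.β_pos k
    rw [abs_div, abs_of_pos (by positivity : 0 < 2 * β k)]
    refine div_le_div₀ (sq_nonneg M) ?_ (by positivity) (by linarith [hβle k])
    rw [abs_le]
    constructor <;> linarith [(hP k).1, (hP k).2, dualSq_nonneg (y k) (z k),
      dualSq_nonneg (trialY A b x y β k) (trialZ g x z β k)]
  have hmain := nsmul_le_of_descent (V := V) (δ := δ) (d := d) (N := N) (K := K)
    (W := fun k => meritValue Φ A b g x y z β k + 4 * M ^ 2 / β k + (∑ i, z k i ^ 2) / β k)
    (a := B + 11 / 2 * (M ^ 2 / β₀)) (c := 4 * M * (v₀ / β₀)) (by positivity)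
    (fun k => ?_) (fun k => ?_) (fun k => ?_) hV hV5 hδ
  · refine hmain.trans (le_of_eq ?_)
    ring
  · have h1 := h.meritValue_succ_add_le hM k (hβ1 k) (hβ2 k) (hP k).1 (hP (k + 1)).1 (hP k).2
      (hdesc k)
    have h2 := mul_le_mul_of_nonneg_left (hvβ k) (by positivity : 0 ≤ 4 * M)
    linarith
  · have h1 := (abs_le.1 (hbd k)).2
    have h2 : 4 * M ^ 2 / β k ≤ 4 * M ^ 2 / β₀ :=
      div_le_div_of_nonneg_left (by positivity) hβ₀ (hβle k)
    have h3 : (∑ i, z k i ^ 2) / β k ≤ M ^ 2 / β₀ :=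
      div_le_div₀ (sq_nonneg M) ((sum_sq_le_dualSq _ _).trans (hP k).1) hβ₀ (hβle k)
    have h4 : M ^ 2 / (2 * β₀) = 1 / 2 * (M ^ 2 / β₀) := by field_simp
    have h5 : 4 * M ^ 2 / β₀ = 4 * (M ^ 2 / β₀) := by ring
    linarith
  · have h1 := (abs_le.1 (hbd k)).1
    have hk := h.β_pos k
    have h2 : 0 ≤ 4 * M ^ 2 / β k := by positivity
    have h3 : 0 ≤ (∑ i, z k i ^ 2) / β k :=
      div_nonneg (Finset.sum_nonneg fun i _ => sq_nonneg _) hk.le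
    have h4 : M ^ 2 / (2 * β₀) = 1 / 2 * (M ^ 2 / β₀) := by field_simp
    have h5 : 0 ≤ M ^ 2 / β₀ := by positivity
    linarith

/-- Some step among `K` consecutive ones is short, provided `K` is large. -/
theorem exists_norm_sub_le (h : IsDualRun A b g x y z β v α p) {Φ : E → ℝ}
    {M B β₀ v₀ ρ ε : ℝ} {N K : ℕ} (hM : 0 ≤ M) (hβ₀ : 0 < β₀) (hv₀ : 0 < v₀) (hρ : 0 < ρ)
    (hε : 0 < ε) (hN : 0 < N)
    (hβ : ∀ k : ℕ, β k = β₀ * √(k + 1)) (hv0 : v 0 = v₀)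
    (hv : ∀ k : ℕ, 1 ≤ k → v k = v₀ / (√(k + 1) * Real.log (k + 1) ^ 2))
    (hP : ∀ k, dualSq (y k) (z k) ≤ M ^ 2 ∧
      dualSq (trialY A b x y β k) (trialZ g x z β k) ≤ M ^ 2)
    (hΦ : ∀ k, |Φ (x (k + 1))| ≤ B)
    (hdesc : ∀ k, meritValue Φ A b g x y z β (k + 1)
        + (3 / 2 * ρ * ‖x (k + 1 + 1) - x (k + 1)‖ ^ 2 - ε / 8 * ‖x (k + 1 + 1) - x (k + 1)‖) ≤
      Φ (x (k + 1))
      + (‖y (k + 1) + β (k + 1) • (A (x (k + 1)) - b)‖ ^ 2 - ‖y (k + 1)‖ ^ 2) / (2 * β (k + 1))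
      + ∑ i, (max (z (k + 1) i + β (k + 1) * g i (x (k + 1))) 0 ^ 2 - z (k + 1) i ^ 2)
        / (2 * β (k + 1)))
    (hK : 2 * B + 11 * M ^ 2 / β₀ + 20 * M * (v₀ / β₀) < K * (2 * ε ^ 2 / (9 * ρ))) :
    ∃ k, N ≤ k ∧ k < N + K ∧ ‖x (k + 1) - x k‖ ≤ 7 * ε / (16 * ρ) := by
  by_contra! hcon
  refine hK.not_ge (h.nsmul_le_of_merit_descent (N := N - 1)
    (δ := fun k => 3 / 2 * ρ * ‖x (k + 1) - x k‖ ^ 2 - ε / 8 * ‖x (k + 1) - x k‖)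
    hM hβ₀ hv₀ hβ hv0 hv hP hΦ hdesc fun k hk hk' => ?_)
  have h1 := (hcon k (by omega) (by omega)).le
  set t := ‖x (k + 1) - x k‖
  set q := 7 * ε / (16 * ρ) with hq
  have hq0 : 0 < q := by positivity
  have h2 : ρ * q = 7 / 16 * ε := by
    rw [hq]
    field_simp
  have h3 : 2 * ε ^ 2 / (9 * ρ) = 32 / 63 * (ε * q) := by
    rw [hq]
    field_simp
    norm_num
  have h4 : 17 / 32 * ε ≤ 3 / 2 * ρ * t - ε / 8 := by
    linarith [mul_le_mul_of_nonneg_left h1 hρ.le]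
  have h5 : q * (17 / 32 * ε) ≤ t * (3 / 2 * ρ * t - ε / 8) :=
    mul_le_mul h1 h4 (by positivity) (hq0.le.trans h1)
  rw [h3]
  linarith [mul_pos hε hq0]

end IsDualRun

end Bounds
section Main

variable {E G ι : Type*} [NormedAddCommGroup E] [InnerProductSpace ℝ E] [CompleteSpace E]
  [NormedAddCommGroup G] [InnerProductSpace ℝ G] [CompleteSpace G] [Fintype ι]

/-- `x` is an `ε`-KKT point of the minimization of `f + h` subject to `A u = b`, `g u ≤ 0`. -/
def IsApproxKKT (X : Set E) (ρ : ℝ) (f h : E → ℝ) (g : ι → E → ℝ) (A : E →L[ℝ] G) (b : G) (ε : ℝ)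
    (x : E) : Prop :=
  ∃ (yy : G) (zz : ι → ℝ), (∀ i, 0 ≤ zz i) ∧
    infDist (0 : E) {w | ∃ ξ ∈ wsubdiff X ρ (fun u => f u + h u) x,
      w = ξ + ContinuousLinearMap.adjoint A yy + ∑ i, zz i • gradient (g i) x} ≤ ε ∧
    √(‖A x - b‖ ^ 2 + ∑ i, max (g i x) 0 ^ 2) ≤ ε ∧
    ∑ i, |zz i * g i x| ≤ ε

theorem IsApproxKKT.of_norm_le {X : Set E} {ρ ε : ℝ} {f h : E → ℝ} {g : ι → E → ℝ}
    {A : E →L[ℝ] G} {b : G} {x ξ : E} {yy : G} {zz : ι → ℝ}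
    (hf : ConvexOn ℝ X fun u => f u + ρ / 2 * ‖u‖ ^ 2) (hx : x ∈ X)
    (hd : DifferentiableAt ℝ f x) (hξ : ξ ∈ csubdiff X h x) (hzz : ∀ i, 0 ≤ zz i)
    (hres : ‖gradient f x + ξ + ContinuousLinearMap.adjoint A yy
      + ∑ i, zz i • gradient (g i) x‖ ≤ ε)
    (hfeas : √(‖A x - b‖ ^ 2 + ∑ i, max (g i x) 0 ^ 2) ≤ ε)
    (hcompl : ∑ i, |zz i * g i x| ≤ ε) : IsApproxKKT X ρ f h g A b ε x := by
  refine ⟨yy, zz, hzz, le_trans ?_ hres, hfeas, hcompl⟩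
  rw [← dist_zero_left]
  exact infDist_le_dist_of_mem ⟨_, gradient_add_mem_wsubdiff hf hx hd hξ, rfl⟩

namespace IsDualRun

variable {A : E →L[ℝ] G} {b : G} {g : ι → E → ℝ} {x : ℕ → E} {y : ℕ → G} {z : ℕ → ι → ℝ}
  {β v α p : ℕ → ℝ}

/-- Dual bound when `Aᵀ` is bounded below by `l` on the trial multipliers. -/
theorem dualSq_le_sq_of_adjoint_ge (h : IsDualRun A b g x y z β v α p) {w : ℕ → E} {e : ℕ → ℝ}
    {l τ κ R L r B ρ D M : ℝ} (hl : 0 < l) (hτ : 0 < τ) (hκ : 0 < κ) (hτR : τ ≤ R)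
    (hτL : τ * L ≤ κ / 2) (hr : 0 ≤ r) (hB : 0 ≤ B) (hρ : 0 ≤ ρ) (hD : 0 ≤ D)
    (he : ∀ k, e k ≤ 1)
    (hY : ∀ k, l * ‖trialY A b x y β k‖ ≤ ‖ContinuousLinearMap.adjoint A (trialY A b x y β k)‖)
    (hkey : ∀ k, dualSq (trialY A b x y β k) (trialZ g x z β k) - dualSq (y k) (z k)
      + dualSq (trialY A b x y β k - y k) (fun i => trialZ g x z β k i - z k i)
      + 2 * β k * κ * ∑ i, trialZ g x z β k i + 2 * β k * R * ‖w k‖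
      ≤ 2 * β k * (D * (B + r + 2 * ρ * D + e k)))
    (hadj : ∀ k, ‖ContinuousLinearMap.adjoint A (trialY A b x y β k)‖ ≤
      ‖w k‖ + r + B + 2 * ρ * D + e k + L * ∑ i, trialZ g x z β k i)
    (hM : (D * (r + B) + 2 * ρ * D ^ 2 + D + τ * (1 + r + B + 2 * ρ * D)) / min (τ * l) (κ / 2) ≤ M)
    (h0 : √(dualSq (y 0) (z 0)) ≤ M) (k : ℕ) :
    dualSq (y k) (z k) ≤ M ^ 2 ∧ dualSq (trialY A b x y β k) (trialZ g x z β k) ≤ M ^ 2 := by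
  have hmin : 0 < min (τ * l) (κ / 2) := by positivity
  refine h.dualSq_le_sq hmin ((Real.sqrt_nonneg _).trans h0)
    (by positivity : 0 ≤ D * (r + B) + 2 * ρ * D ^ 2 + D + τ * (1 + r + B + 2 * ρ * D))
    ((div_le_iff₀' hmin).1 hM) h0 (fun k => ?_) k
  set S := ∑ i, trialZ g x z β k i
  have hS : 0 ≤ S := Finset.sum_nonneg fun i _ => trialZ_nonneg k i
  have h1 : min (τ * l) (κ / 2) * √(dualSq (trialY A b x y β k) (trialZ g x z β k)) ≤
      τ * (l * ‖trialY A b x y β k‖) + κ / 2 * S := calc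
    _ ≤ min (τ * l) (κ / 2) * (‖trialY A b x y β k‖ + S) :=
      mul_le_mul_of_nonneg_left (sqrt_dualSq_le _ fun i => trialZ_nonneg k i) hmin.le
    _ ≤ _ := by
      rw [mul_add, ← mul_assoc]
      exact add_le_add (mul_le_mul_of_nonneg_right (min_le_left _ _) (norm_nonneg _))
        (mul_le_mul_of_nonneg_right (min_le_right _ _) hS)
  have h2 := mul_le_mul_of_nonneg_left ((hY k).trans (hadj k)) hτ.le
  have h3 := mul_le_mul_of_nonneg_right hτR (norm_nonneg (w k))
  have h4 := mul_le_mul_of_nonneg_right hτL hS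
  have h5 := mul_le_mul_of_nonneg_left (he k) hτ.le
  have h6 := mul_le_mul_of_nonneg_left (he k) hD
  have h7 := dualSq_nonneg (trialY A b x y β k - y k) (fun i => trialZ g x z β k i - z k i)
  have h8 : min (τ * l) (κ / 2) * √(dualSq (trialY A b x y β k) (trialZ g x z β k))
      + D * (B + r + 2 * ρ * D + e k) ≤
      D * (r + B) + 2 * ρ * D ^ 2 + D + τ * (1 + r + B + 2 * ρ * D) + κ * S + R * ‖w k‖ := by
    nlinarith
  nlinarith [hkey k, mul_le_mul_of_nonneg_left h8 (mul_pos two_pos (h.β_pos k)).le]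

/-- Bounded multipliers yield an approximate KKT point. -/
theorem exists_isApproxKKT (hrun : IsDualRun A b g x y z β v α p) {X : Set E} {f h : E → ℝ}
    {ζ : ℕ → E} {M B C β₀ v₀ ρ ε : ℝ} {N K : ℕ} (hM : 0 ≤ M) (hβ₀ : 0 < β₀) (hv₀ : 0 < v₀)
    (hρ : 0 < ρ) (hε : 0 < ε) (hN : 0 < N)
    (hβ : ∀ k : ℕ, β k = β₀ * √(k + 1)) (hv0 : v 0 = v₀)
    (hv : ∀ k : ℕ, 1 ≤ k → v k = v₀ / (√(k + 1) * Real.log (k + 1) ^ 2))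
    (hf : ConvexOn ℝ X fun u => f u + ρ / 2 * ‖u‖ ^ 2) (hfd : ∀ u ∈ X, DifferentiableAt ℝ f u)
    (hg : ∀ i, ∀ u ∈ X, ∀ u', g i u + ⟪gradient (g i) u, u' - u⟫ ≤ g i u')
    (hx : ∀ k, x (k + 1) ∈ X) (hζ : ∀ k, ζ k ∈ csubdiff X h (x (k + 1)))
    (hres : ∀ k, ‖gradient f (x (k + 1)) + ζ k
      + ContinuousLinearMap.adjoint A (y k + β k • (A (x (k + 1)) - b))
      + (∑ i, max (z k i + β k * g i (x (k + 1))) 0 • gradient (g i) (x (k + 1)))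
      + (2 * ρ) • (x (k + 1) - x k)‖ ≤ ε / 8)
    (hP : ∀ k, dualSq (y k) (z k) ≤ M ^ 2 ∧
      dualSq (trialY A b x y β k) (trialZ g x z β k) ≤ M ^ 2)
    (hΦ : ∀ u ∈ X, |f u + h u| ≤ B)
    (hM₁ : 2 * M ≤ C) (hM₂ : 5 / 2 * M ^ 2 ≤ C)
    (hCN : C ^ 2 / (β₀ ^ 2 * ε ^ 2) ≤ N)
    (hK : 2 * B + 11 * M ^ 2 / β₀ + 20 * M * (v₀ / β₀) < K * (2 * ε ^ 2 / (9 * ρ))) :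
    ∃ k, k < N + K ∧ x (k + 1) ∈ X ∧ IsApproxKKT X ρ f h g A b ε (x (k + 1)) := by
  obtain ⟨k, hkN, hkK, hk⟩ := hrun.exists_norm_sub_le (Φ := fun u => f u + h u) hM hβ₀ hv₀ hρ hε hN
    hβ hv0 hv hP (fun k => hΦ _ (hx k))
    (fun k => augmented_lagrangian_descent (hrun.β_pos (k + 1))
      (weaklyConvex_inner_gradient_le hf (hx (k + 1)) (hx k) (hfd _ (hx (k + 1))))
      (hζ (k + 1) _ (hx k)) (fun i => hg i _ (hx (k + 1)) _) (hres (k + 1))) hK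
  have hβk := hrun.β_pos k
  have hβC : C ≤ β k * ε := by
    rw [hβ]
    exact le_mul_sqrt_mul_of_sq_div_le hβ₀ hε (hCN.trans (Nat.cast_le.2 hkN))
  refine ⟨k, hkK, hx k, .of_norm_le (yy := trialY A b x y β k) (zz := trialZ g x z β k) hf (hx k)
    (hfd _ (hx k)) (hζ k) (fun i => trialZ_nonneg k i) ?_ ?_ ?_⟩
  · have h1 : ‖(2 * ρ) • (x (k + 1) - x k)‖ ≤ 7 * ε / 8 := by
      rw [norm_smul, Real.norm_of_nonneg (by positivity)]
      refine (mul_le_mul_of_nonneg_left hk (by positivity)).trans (le_of_eq ?_)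
      field_simp
      norm_num
    have h2 := norm_le_add_norm_add (gradient f (x (k + 1)) + ζ k
      + ContinuousLinearMap.adjoint A (trialY A b x y β k)
      + ∑ i, trialZ g x z β k i • gradient (g i) (x (k + 1))) ((2 * ρ) • (x (k + 1) - x k))
    have h3 := hres k
    unfold trialY trialZ at h2 ⊢
    linarith
  · rw [← hrun.p_eq]
    exact le_of_mul_le_mul_left
      ((hrun.p_le_of_dualSq_le hM k (hP k).1 (hP k).2).trans (hM₁.trans hβC)) hβk
  · have h1 := hrun.two_mul_sum_abs_le k (hP k).1 (hP k).2
    exact le_of_mul_le_mul_left (by linarith) hβk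

end IsDualRun

end Main
/-- **Theorem 1, outer iteration complexity in the smooth case.**
Given `ε > 0`, under Assumptions (A1)–(A5), let `{x^k, y^k, z^k}` be generated by DPALM with
the parameter choice `β_k = β₀√(k+1)`, `v_k = v₀/(√(k+1)(log(k+1))²)`, where each `x^{k+1}`
satisfies `dist(0, ∂_x L̃_{β_k}(x^{k+1}; y^k, z^k)) ≤ ε_k := min{ε/8, √(ρ/(2β_k)), 1}`. Then
for some `k < K := K₁ + K₂`, with `K₁ := ⌈max{C_p²/(β₀²ε²), (4B_p+5C_p²)²/(16β₀²ε²)}⌉` and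
`K₂ := ⌈5 C_x ρ ε⁻²⌉`, the iterate `x^{k+1}` is an `ε`-KKT point of problem (P): there exist
multipliers `y ∈ ℝⁿ` and `z ≥ 0` with
`dist(0, ∂F(x^{k+1}) + J_g(x^{k+1})ᵀz + Aᵀy) ≤ ε`,
`√(‖Ax^{k+1}−b‖² + ‖[g(x^{k+1})]_+‖²) ≤ ε`, and `Σ_i |z_i g_i(x^{k+1})| ≤ ε`. -/
theorem dpalm_smooth_eps_kkt
    (d n m : ℕ) (hm : 0 < m)
    (A : EuclideanSpace ℝ (Fin d) →L[ℝ] EuclideanSpace ℝ (Fin n))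
    (b : EuclideanSpace ℝ (Fin n))
    (f h : EuclideanSpace ℝ (Fin d) → ℝ)
    (g : Fin m → EuclideanSpace ℝ (Fin d) → ℝ)
    (X : Set (EuclideanSpace ℝ (Fin d)))
    -- (A1): X = dom F is compact with diameter D, f is ρ-weakly convex on X, h closed convex
    (hXcomp : IsCompact X) (hXne : X.Nonempty)
    (D : ℝ) (hD : IsGreatest {t | ∃ x₁ ∈ X, ∃ x₂ ∈ X, t = ‖x₁ - x₂‖} D)
    (ρ : ℝ) (hρ : 0 < ρ)
    (hfwc : ConvexOn ℝ X (fun u => f u + ρ / 2 * ‖u‖ ^ 2))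
    (hhconv : ConvexOn ℝ X h) (hhlsc : LowerSemicontinuous h)
    -- (A2): each gᵢ is convex, L_g-smooth on an open set U ⊇ X, with the bounds (B_g)
    (Lg Bg : ℝ) (hBg : 0 < Bg)
    (U : Set (EuclideanSpace ℝ (Fin d))) (hUopen : IsOpen U) (hXU : X ⊆ U)
    (hgconv : ∀ i, ConvexOn ℝ Set.univ (g i))
    (hgdiff : ∀ i, DifferentiableOn ℝ (g i) U)
    (hgsmooth : ∀ i, ∀ u ∈ U, ∀ u' ∈ U, ‖gradient (g i) u - gradient (g i) u'‖ ≤ Lg * ‖u - u'‖)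
    (hgbound : ∀ i, ∀ u ∈ X, |g i u| ≤ Bg ∧ ‖gradient (g i) u‖ ≤ Bg)
    (hglip : ∀ i, ∀ u ∈ X, ∀ u' ∈ X, |g i u - g i u'| ≤ Bg * ‖u - u'‖)
    -- (A3): strictly feasible interior point
    (xfeas : EuclideanSpace ℝ (Fin d)) (hxfeas : xfeas ∈ interior X)
    (hAxfeas : A xfeas = b)
    (gmin : ℝ) (hgminpos : 0 < gmin)
    (hgmin : IsLeast {t | ∃ i, t = -(g i xfeas)} gmin)
    -- (A4): ∂h(x) ⊆ N_X(x) + B_{r_h} and ∂h(x) ≠ ∅ on X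
    (rh : ℝ) (hrh : 0 < rh)
    (hhsubne : ∀ u ∈ X, (csubdiff X h u).Nonempty)
    (hhsub : ∀ u ∈ X, ∀ ξ ∈ csubdiff X h u,
      ∃ w v, ξ = w + v ∧ (∀ u' ∈ X, ⟪w, u' - u⟫ ≤ 0) ∧ ‖v‖ ≤ rh)
    -- DPALM iterates and dual updates
    (β v : ℕ → ℝ) (hβpos : ∀ k, 0 < β k) (hβmono : Monotone β) (hvpos : ∀ k, 0 < v k)
    (x : ℕ → EuclideanSpace ℝ (Fin d))
    (y : ℕ → EuclideanSpace ℝ (Fin n)) (z : ℕ → Fin m → ℝ)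
    (hx0 : x 0 ∈ X) (hy0 : ∃ w, A w = y 0) (hz0 : ∀ i, 0 ≤ z 0 i)
    (α pfeas : ℕ → ℝ)
    (hpfeas : ∀ k, pfeas k =
      Real.sqrt (‖A (x (k + 1)) - b‖ ^ 2 + ∑ i, max (g i (x (k + 1))) 0 ^ 2))
    (hα : ∀ k, α k = if pfeas k = 0 then β k else min (β k) (v k / pfeas k))
    (hyupd : ∀ k, y (k + 1) = y k + α k • (A (x (k + 1)) - b))
    (hzupd : ∀ k, ∀ i, z (k + 1) i = z k i + α k * max (-(z k i) / β k) (g i (x (k + 1))))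
    -- (A5): f is L_f-smooth on an open set containing X, with ‖∇f‖ ≤ B_f on X
    (Lf Bf : ℝ) (hBf : 0 < Bf)
    (U' : Set (EuclideanSpace ℝ (Fin d))) (hU'open : IsOpen U') (hXU' : X ⊆ U')
    (hfdiff : DifferentiableOn ℝ f U')
    (hfsmooth : ∀ u ∈ U', ∀ u' ∈ U', ‖gradient f u - gradient f u'‖ ≤ Lf * ‖u - u'‖)
    (hfgradbd : ∀ u ∈ X, ‖gradient f u‖ ≤ Bf)
    -- the parameter choice β_k = β₀√(k+1), v_k = v₀/(√(k+1)(log(k+1))²) (k ≥ 1)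
    (β₀ v₀ : ℝ) (hβ₀ : 0 < β₀) (hv₀ : 0 < v₀)
    (hβch : ∀ k : ℕ, β k = β₀ * Real.sqrt (k + 1))
    (hvch0 : v 0 = v₀)
    (hvch : ∀ k : ℕ, 1 ≤ k → v k = v₀ / (Real.sqrt (k + 1) * Real.log (k + 1) ^ 2))
    -- the accuracy requirement: x^{k+1} ∈ X is an ε_k-stationary point of the
    -- strongly convex subproblem  min_x L̃_{β_k}(x; y^k, z^k)
    (ε : ℝ) (hεpos : 0 < ε)
    (εseq : ℕ → ℝ)
    (hεseq : ∀ k, εseq k = min (ε / 8) (min (Real.sqrt (ρ / (2 * β k))) 1))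
    (happrox : ∀ k, x (k + 1) ∈ X ∧
      Metric.infDist (0 : EuclideanSpace ℝ (Fin d))
        {w | ∃ ξf ∈ wsubdiff X ρ f (x (k + 1)), ∃ ξh ∈ csubdiff X h (x (k + 1)),
          w = ξf + ξh
            + ContinuousLinearMap.adjoint A (y k + β k • (A (x (k + 1)) - b))
            + (∑ i, max (z k i + β k * g i (x (k + 1))) 0 • gradient (g i) (x (k + 1)))
            + (2 * ρ) • (x (k + 1) - x k)} ≤ εseq k)
    -- the constants τ, B̄, λ⁺_min(AAᵀ), θ, B₀, B_p = B₀, Q, C₁, Ĉ_p, C_p = 2Ĉ_p, Fmax, C_x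
    (τ Bbar lamm θ B0 Bp Q C₁ Chp Cp Fmax Cx : ℝ)
    (hτ : τ = min (gmin / (2 * Real.sqrt m * Bg)) (Metric.infDist xfeas (frontier X)))
    (hBbar : Bbar = D * (rh + Bf) + 2 * ρ * D ^ 2 + D + τ * (1 + rh + Bf + 2 * ρ * D))
    (hlamm : lamm = sInf {μ : ℝ | 0 < μ ∧ ∃ w : EuclideanSpace ℝ (Fin n), w ≠ 0 ∧
        A (ContinuousLinearMap.adjoint A w) = μ • w})
    (hθ : θ = Bbar / min (τ * Real.sqrt lamm) (gmin / 2))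
    (hB0 : B0 = max (Real.sqrt (‖y 0‖ ^ 2 + ∑ i, z 0 i ^ 2)) θ)
    (hBp : Bp = B0)
    (hQ : Q = D * (Bf + 2 * ρ * D + rh))
    (hC₁ : C₁ = 1 / D + 1 / Metric.infDist xfeas (frontier X) + Bg / gmin)
    (hChp : Chp = 2 * (Bp + Real.sqrt (Q ^ 2 / gmin ^ 2
        + Q ^ 2 * ‖(mpPinv (A.comp (ContinuousLinearMap.adjoint A))).comp A‖ ^ 2 * C₁ ^ 2)) + 1)
    (hCp : Cp = 2 * Chp)
    (hFmax : IsGreatest ((fun u => |f u + h u|) '' X) Fmax)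
    (hCx : Cx = 2 * Fmax + 1 / (4 * β₀) * (14 * Cp ^ 2 + 8 * Bp * Cp + 7 * Bp ^ 2)
        + (10 * Cp + 4 * Bp) * (v₀ / β₀)
        + β₀ / 2 * (‖A (x 0) - b‖ ^ 2 + ∑ i, max (g i (x 0) + z 0 i / β₀) 0 ^ 2)
        + |⟪y 0, A (x 0) - b⟫|)
    (K₁ K₂ : ℕ)
    (hK₁ : K₁ = ⌈max (Cp ^ 2 / (β₀ ^ 2 * ε ^ 2)) ((4 * Bp + 5 * Cp ^ 2) ^ 2 / (16 * β₀ ^ 2 * ε ^ 2))⌉₊)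
    (hK₂ : K₂ = ⌈5 * Cx * ρ / ε ^ 2⌉₊)
    :
    ∃ k : ℕ, k < K₁ + K₂ ∧
      x (k + 1) ∈ X ∧
      ∃ (yy : EuclideanSpace ℝ (Fin n)) (zz : Fin m → ℝ),
        (∀ i, 0 ≤ zz i) ∧
        Metric.infDist (0 : EuclideanSpace ℝ (Fin d))
          {w | ∃ ξ ∈ wsubdiff X ρ (fun u => f u + h u) (x (k + 1)),
            w = ξ + ContinuousLinearMap.adjoint A yy
              + ∑ i, zz i • gradient (g i) (x (k + 1))} ≤ ε ∧
        Real.sqrt (‖A (x (k + 1)) - b‖ ^ 2 + ∑ i, max (g i (x (k + 1))) 0 ^ 2) ≤ ε ∧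
        ∑ i, |zz i * g i (x (k + 1))| ≤ ε := by
  have hrun : IsDualRun A b g x y z β v α pfeas :=
    ⟨hβpos, hvpos, hpfeas, hα, hyupd, hzupd, hz0⟩
  have hxX : ∀ k, x k ∈ X := fun k => by
    cases k with
    | zero => exact hx0
    | succ k => exact (happrox k).1
  have hdiam : ∀ u ∈ X, ∀ u' ∈ X, ‖u - u'‖ ≤ D := fun u hu u' hu' => hD.2 ⟨u, hu, u', hu', rfl⟩
  have hD0 : 0 ≤ D := (norm_nonneg _).trans (hdiam _ hx0 _ hx0)
  have hxfX : xfeas ∈ X := interior_subset hxfeas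
  have hfd : ∀ u ∈ X, DifferentiableAt ℝ f u := fun u hu =>
    (hfdiff u (hXU' hu)).differentiableAt (hU'open.mem_nhds (hXU' hu))
  have hgd : ∀ i, ∀ u ∈ X, DifferentiableAt ℝ (g i) u := fun i u hu =>
    (hgdiff i u (hXU hu)).differentiableAt (hUopen.mem_nhds (hXU hu))
  have hgm : ∀ i, g i xfeas ≤ -gmin := fun i => by linarith [hgmin.2 ⟨i, rfl⟩]
  have hggrad : ∀ i, ∀ u ∈ X, ∀ u', g i u + ⟪gradient (g i) u, u' - u⟫ ≤ g i u' :=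
    fun i u hu u' => (hgconv i).inner_gradient_le (Set.mem_univ _) (Set.mem_univ _) (hgd i u hu)
  have hstat := fun k => exists_mem_csubdiff_norm_le hfwc (happrox k).1 (hfd _ (happrox k).1)
    (hhsubne _ (happrox k).1) (happrox k).2
  choose ζ hζ hres using hstat
  choose w u hwu hw hu using fun k => hhsub _ (happrox k).1 _ (hζ k)
  have hε8 : ∀ k, εseq k ≤ ε / 8 := fun k => (hεseq k).trans_le (min_le_left _ _)
  have hε1 : ∀ k, εseq k ≤ 1 := fun k =>
    (hεseq k).trans_le ((min_le_right _ _).trans (min_le_right _ _))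
  have hερ : ∀ k, εseq k ≤ √(ρ / (2 * β k)) := fun k =>
    (hεseq k).trans_le ((min_le_right _ _).trans (min_le_left _ _))
  have hR : 0 ≤ infDist xfeas (frontier X) := infDist_nonneg
  have hkey : ∀ k, dualSq (trialY A b x y β k) (trialZ g x z β k) - dualSq (y k) (z k)
      + dualSq (trialY A b x y β k - y k) (fun i => trialZ g x z β k i - z k i)
      + 2 * β k * gmin * ∑ i, trialZ g x z β k i
      + 2 * β k * infDist xfeas (frontier X) * ‖w k‖
      ≤ 2 * β k * (D * (Bf + rh + 2 * ρ * D + εseq k)) := fun k => by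
    refine multiplier_step_le (hβpos k) hρ hAxfeas (hfgradbd _ (happrox k).1) (hu k)
      (infDist_frontier_mul_norm_le hxfeas (hw k)) (hdiam _ (happrox k).1 _ hxfX)
      (hdiam _ (happrox k).1 _ (hxX k)) (fun i => ?_) (hwu k ▸ hres k)
    have h1 := hggrad i _ (happrox k).1 xfeas
    rw [← neg_sub, inner_neg_right] at h1
    linarith [hgm i]
  have hadj : ∀ k, ‖ContinuousLinearMap.adjoint A (trialY A b x y β k)‖ ≤
      ‖w k‖ + rh + Bf + 2 * ρ * D + εseq k + Bg * ∑ i, trialZ g x z β k i := fun k =>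
    norm_adjoint_multiplier_le hρ (hfgradbd _ (happrox k).1) (hu k)
      (hdiam _ (happrox k).1 _ (hxX k)) (fun i => trialZ_nonneg k i)
      (fun i => (hgbound i _ (happrox k).1).2) (hwu k ▸ hres k)
  have hBp0 : √(dualSq (y 0) (z 0)) ≤ Bp := by
    rw [hBp, hB0]
    exact le_max_left _ _
  have hθBp : θ ≤ Bp := by
    rw [hBp, hB0]
    exact le_max_right _ _
  have hBpnn : 0 ≤ Bp := (Real.sqrt_nonneg _).trans hBp0
  have hQ0 : 0 ≤ Q := by
    rw [hQ]
    positivity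
  have hQC : 4 * Q ≤ gmin * (Cp - 2 - 4 * Bp) := by
    have h1 : Q / gmin ≤ (Chp - 1) / 2 - Bp := by
      rw [hChp]
      have : Q / gmin ≤ √(Q ^ 2 / gmin ^ 2
          + Q ^ 2 * ‖(mpPinv (A.comp (ContinuousLinearMap.adjoint A))).comp A‖ ^ 2 * C₁ ^ 2) := by
        refine Real.le_sqrt_of_sq_le ?_
        rw [div_pow]
        exact le_add_of_nonneg_right (by positivity)
      linarith
    rw [div_le_iff₀' hgminpos] at h1
    rw [hCp]
    linarith
  have hCp2 : 2 + 4 * Bp ≤ Cp := by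
    have := nonneg_of_mul_nonneg_right (hQC.trans' (by positivity)) hgminpos
    linarith
  have hCp0 : 0 < Cp := by linarith
  have hFmax0 : 0 ≤ Fmax := (abs_nonneg _).trans (hFmax.2 ⟨_, hx0, rfl⟩)
  have hCx' : 2 * Fmax + 7 / 2 * Cp ^ 2 / β₀ + 10 * Cp * (v₀ / β₀) ≤ Cx := by
    have h1 : 0 ≤ β₀ / 2 * (‖A (x 0) - b‖ ^ 2 + ∑ i, max (g i (x 0) + z 0 i / β₀) 0 ^ 2) :=
      mul_nonneg (by positivity)
        (add_nonneg (sq_nonneg _) (Finset.sum_nonneg fun i _ => sq_nonneg _))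
    have h2 : 0 ≤ 1 / (4 * β₀) * (8 * Bp * Cp + 7 * Bp ^ 2) + 4 * Bp * (v₀ / β₀) := by positivity
    have h3 : 7 / 2 * Cp ^ 2 / β₀ = 1 / (4 * β₀) * (14 * Cp ^ 2) := by
      field_simp
      norm_num
    rw [hCx, h3]
    linarith [abs_nonneg ⟪y 0, A (x 0) - b⟫]
  have hCx0 : 0 < Cx := hCx'.trans_lt' (by positivity)
  have hK₂pos : 0 < K₂ := by
    rw [hK₂, Nat.ceil_pos]
    positivity
  have hK₁a : Cp ^ 2 / (β₀ ^ 2 * ε ^ 2) ≤ K₁ := by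
    rw [hK₁]
    exact (le_max_left _ _).trans (Nat.le_ceil _)
  have hK₁b : (4 * Bp + 5 * Cp ^ 2) ^ 2 / (16 * β₀ ^ 2 * ε ^ 2) ≤ K₁ := by
    rw [hK₁]
    exact (le_max_right _ _).trans (Nat.le_ceil _)
  have hK₁pos : 0 < K₁ := by
    rw [← Nat.cast_pos (α := ℝ)]
    exact hK₁a.trans_lt' (by positivity)
  have hconcl : ∀ M, 0 ≤ M → 2 * M ≤ Cp → (∀ k, dualSq (y k) (z k) ≤ M ^ 2 ∧
      dualSq (trialY A b x y β k) (trialZ g x z β k) ≤ M ^ 2) →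
      ∃ k, k < K₁ + K₂ ∧ x (k + 1) ∈ X ∧ IsApproxKKT X ρ f h g A b ε (x (k + 1)) := by
    intro M hM hMC hdual
    have hM2 : M ^ 2 ≤ Cp ^ 2 / 4 := by
      have := pow_le_pow_left₀ (by positivity) hMC 2
      linarith
    refine hrun.exists_isApproxKKT (C := max Cp ((4 * Bp + 5 * Cp ^ 2) / 4)) hM hβ₀ hv₀ hρ hεpos
      hK₁pos hβch hvch0 hvch hfwc hfd hggrad (fun k => (happrox k).1) hζ
      (fun k => (hres k).trans (hε8 k)) hdual (fun e he => hFmax.2 ⟨e, he, rfl⟩)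
      (le_max_of_le_left hMC) (le_max_of_le_right (by linarith [sq_nonneg Cp])) ?_ ?_
    · rcases max_choice Cp ((4 * Bp + 5 * Cp ^ 2) / 4) with hc | hc <;> rw [hc]
      · exact hK₁a
      · refine hK₁b.trans' (le_of_eq ?_)
        field_simp
        norm_num
    · have h1 : 5 * Cx * ρ / ε ^ 2 ≤ K₂ := hK₂ ▸ Nat.le_ceil _
      have h2 : 10 / 9 * Cx ≤ K₂ * (2 * ε ^ 2 / (9 * ρ)) := by
        refine le_trans (le_of_eq ?_) (mul_le_mul_of_nonneg_right h1 (by positivity))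
        field_simp
        norm_num
      have h3 : 11 * M ^ 2 / β₀ ≤ 7 / 2 * Cp ^ 2 / β₀ :=
        div_le_div_of_nonneg_right (by linarith [sq_nonneg Cp]) hβ₀.le
      have h4 : 20 * M * (v₀ / β₀) ≤ 10 * Cp * (v₀ / β₀) :=
        mul_le_mul_of_nonneg_right (by linarith) (by positivity)
      linarith
  rcases lt_or_ge 0 lamm with hlam | hlam
  · obtain ⟨μ, hμ0, e, he, hμ⟩ : {μ : ℝ | 0 < μ ∧ ∃ w : EuclideanSpace ℝ (Fin n), w ≠ 0 ∧
        A (ContinuousLinearMap.adjoint A w) = μ • w}.Nonempty := by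
      by_contra hne
      rw [Set.not_nonempty_iff_eq_empty] at hne
      rw [hlamm, hne, Real.sInf_empty] at hlam
      exact hlam.false
    have : Nontrivial (EuclideanSpace ℝ (Fin d)) := by
      refine ⟨ContinuousLinearMap.adjoint A e, 0, fun h0 => ?_⟩
      rw [h0, map_zero, eq_comm, smul_eq_zero] at hμ
      exact hμ.elim hμ0.ne' he
    have hm1 : 1 ≤ √(m : ℝ) := Real.one_le_sqrt.2 (by exact_mod_cast hm)
    have hτ0 : 0 < τ := by
      rw [hτ]
      exact lt_min (by positivity) (infDist_frontier_pos hXcomp hxfeas)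
    have hτg : τ * Bg ≤ gmin / 2 := by
      have h1 : τ ≤ gmin / (2 * √m * Bg) := hτ.trans_le (min_le_left _ _)
      rw [le_div_iff₀ (by positivity)] at h1
      linarith [le_mul_of_one_le_right (mul_pos hτ0 hBg).le hm1]
    refine hconcl Bp hBpnn (by linarith) (hrun.dualSq_le_sq_of_adjoint_ge
      (Real.sqrt_pos.2 hlam) hτ0 hgminpos (hτ.trans_le (min_le_right _ _)) hτg hrh.le hBf.le hρ.le
      hD0 hε1 (fun k => ?_) hkey hadj ?_ hBp0)
    · obtain ⟨e', he'⟩ := hrun.exists_apply_eq_trialY hy0 ⟨_, hAxfeas⟩ k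
      rw [← he', hlamm]
      exact sqrt_sInf_posEigenvalues_mul_norm_le A e'
    · rw [← hBbar, ← hθ]
      exact hθBp
  · have hA : ∀ e, A e = 0 := apply_eq_zero_of_sInf_posEigenvalues_nonpos (hlamm ▸ hlam)
    have hstep : ∀ k, dualSq (trialY A b x y β k) (trialZ g x z β k) - dualSq (y k) (z k)
        + dualSq (trialY A b x y β k - y k) (fun i => trialZ g x z β k i - z k i)
        + 2 * β k * gmin * √(dualSq (trialY A b x y β k) (trialZ g x z β k)) ≤
        2 * β k * (Q + D * εseq k) := fun k => by
      refine hrun.dualSq_step_of_eq_zero hgminpos (mul_nonneg hR (norm_nonneg (w k))) k ?_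
        ((hkey k).trans' (le_of_eq (by ring)) |>.trans_eq (by rw [hQ]; ring))
      obtain ⟨e, he⟩ := hrun.exists_apply_eq_trialY hy0 ⟨_, hAxfeas⟩ k
      rw [← he, hA]
    rcases le_or_gt (Bf + rh) ε with hsmall | hlarge
    · obtain ⟨k, hk, hpk⟩ := exists_feasible_step (N := fun k => dualSq (y k) (z k)) (K := K₁)
        (C := Cp) hβ₀ hv₀ hεpos hgminpos hQ0 hD0 hρ (by linarith)
        (by linarith [mul_nonneg hgminpos.le hBpnn])
        (by rw [hQ]; linarith [mul_nonneg hD0 hBf.le, mul_nonneg hD0 hrh.le])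
        hβch hvpos hvch hερ
        (by
          rw [div_le_iff₀ (by positivity)] at hK₁b
          linarith [mul_nonneg hBpnn (sq_nonneg Cp), sq_nonneg Bp])
        (((Real.sqrt_le_left hBpnn).1 hBp0).trans (pow_le_pow_left₀ hBpnn (by linarith) 2))
        (fun k => hrun.sq_β_mul_p_le_of_eq k (by rw [← hAxfeas, hA, hA])) hrun.α_div_β_eq
        hrun.dualSq_succ_le
        (fun k => (hstep k).trans' (add_le_add_left (add_le_add_right (hrun.sq_β_mul_p_le k) _) _))
      obtain ⟨ξ, hξ, hξr⟩ := exists_csubdiff_norm_le hhconv.1 hhsubne hhlsc hhsub hxfeas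
        (happrox k).1
      refine ⟨k, by omega, (happrox k).1, IsApproxKKT.of_norm_le (yy := 0) (zz := 0) hfwc
        (happrox k).1 (hfd _ (happrox k).1) hξ (fun i => le_rfl) ?_
        ((hpfeas k).symm.trans_le hpk) (by simpa using hεpos.le)⟩
      have h1 := norm_add_le (gradient f (x (k + 1))) ξ
      simp only [map_zero, add_zero, Pi.zero_apply, zero_smul, Finset.sum_const_zero]
      linarith [hfgradbd _ (happrox k).1]
    · refine hconcl (max Bp (9 / 8 * Q / gmin)) (le_max_of_le_left hBpnn) ?_
        (hrun.dualSq_le_sq hgminpos (le_max_of_le_left hBpnn)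
          (by positivity : 0 ≤ 9 / 8 * Q) ?_ (le_max_of_le_left hBp0) fun k => ?_)
      · rcases max_choice Bp (9 / 8 * Q / gmin) with hc | hc <;> rw [hc]
        · linarith
        · rw [mul_div_assoc', div_le_iff₀ hgminpos]
          linarith [mul_nonneg hgminpos.le hBpnn]
      · rw [← div_le_iff₀' hgminpos]
        exact le_max_right _ _
      · have h1 : D * εseq k ≤ Q / 8 := by
          have h2 : D * ε ≤ Q := by
            rw [hQ]
            exact mul_le_mul_of_nonneg_left (by linarith [mul_nonneg hρ.le hD0]) hD0
          linarith [mul_le_mul_of_nonneg_left (hε8 k) hD0]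
        have h3 := mul_le_mul_of_nonneg_left (add_le_add_right h1 Q)
          (mul_pos two_pos (hβpos k)).le
        linarith [hstep k, dualSq_nonneg (trialY A b x y β k - y k)
          (fun i => trialZ g x z β k i - z k i)]
end
end

section
/- Let ρ, β₀, C₂, C₃, D > 0, let K ≥ 1 be an integer, let ε₀ ≥ ε₁ ≥ … ≥ ε_K be positive reals with ε₀ ≤ 1, define L_k := C₃ + √(k+1)·β₀·C₂ for each k, and assume 9·D·L₀·√(L₀/ρ) ≥ 1. Then Σ_{k=0}^{K−1} ( ⌈max{1/log 2, 2√(L_k/ρ)}·log(9·D·L_k·√(L_k/ρ)/ε_k)⌉ + 1 ) ≤ 2K + K·(2√(C₃/ρ) + 2√(√K·β₀·C₂/ρ) + 1/log 2)·log( 9·ε_K⁻¹·D·√(1/ρ)·(C₃ + √K·β₀·C₂)^{3/2} ). -/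
/-- Subadditivity of the real square root. -/
lemma Real.sqrt_add_le_sqrt_add_sqrt_of_nonneg {x y : ℝ} (hx : 0 ≤ x) (hy : 0 ≤ y) :
    √(x + y) ≤ √x + √y := by
  rw [Real.sqrt_le_left (by positivity)]
  nlinarith [Real.sq_sqrt hx, Real.sq_sqrt hy, Real.sqrt_nonneg x, Real.sqrt_nonneg y,
    mul_nonneg (Real.sqrt_nonneg x) (Real.sqrt_nonneg y)]

/-- `x^{3/2}` written through square roots. -/
lemma Real.sqrt_one_div_mul_rpow_three_halves {x r : ℝ} (hx : 0 < x) :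
    √(1 / r) * x ^ ((3 : ℝ) / 2) = x * √(x / r) := by
  have h : x ^ ((3 : ℝ) / 2) = x * √x := by
    rw [show (3 : ℝ) / 2 = 1 + 1 / 2 by norm_num, Real.rpow_add hx, Real.rpow_one,
      ← Real.sqrt_eq_rpow]
  rw [h, Real.sqrt_div hx.le, Real.sqrt_div zero_le_one, Real.sqrt_one]
  ring


/-- Let `ρ, β₀, C₂, C₃, D > 0`, `K ≥ 1` an integer, `ε₀ ≥ ε₁ ≥ … ≥ ε_K`
positive reals with `ε₀ ≤ 1`, set `L_k := C₃ + √(k+1)·β₀·C₂`, and assume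
`9·D·L₀·√(L₀/ρ) ≥ 1`. Then
`Σ_{k=0}^{K−1} ( ⌈max{1/log 2, 2√(L_k/ρ)}·log(9·D·L_k·√(L_k/ρ)/ε_k)⌉ + 1 )
  ≤ 2K + K·(2√(C₃/ρ) + 2√(√K·β₀·C₂/ρ) + 1/log 2)
      ·log( 9·ε_K⁻¹·D·√(1/ρ)·(C₃ + √K·β₀·C₂)^{3/2} )`. -/
theorem total_complexity_arith_bound
    (ρ β₀ C₂ C₃ D : ℝ)
    (hρ : 0 < ρ) (hβ₀ : 0 < β₀) (hC₂ : 0 < C₂) (hC₃ : 0 < C₃) (hD : 0 < D)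
    (K : ℕ) (hK : 1 ≤ K)
    (ε : ℕ → ℝ)
    (hεpos : ∀ k, k ≤ K → 0 < ε k)
    (hεanti : ∀ j k, j ≤ k → k ≤ K → ε k ≤ ε j)
    (hε0 : ε 0 ≤ 1)
    (L : ℕ → ℝ) (hL : ∀ k : ℕ, L k = C₃ + Real.sqrt (k + 1) * β₀ * C₂)
    (hbig : 1 ≤ 9 * D * L 0 * Real.sqrt (L 0 / ρ)) :
    ∑ k ∈ Finset.range K,
        (((⌈max (1 / Real.log 2) (2 * Real.sqrt (L k / ρ)) *
              Real.log (9 * D * L k * Real.sqrt (L k / ρ) / ε k)⌉ : ℤ) : ℝ) + 1) ≤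
      2 * K + K * (2 * Real.sqrt (C₃ / ρ) + 2 * Real.sqrt (Real.sqrt K * β₀ * C₂ / ρ)
            + 1 / Real.log 2) *
          Real.log (9 * (ε K)⁻¹ * D * Real.sqrt (1 / ρ)
            * (C₃ + Real.sqrt K * β₀ * C₂) ^ ((3 : ℝ) / 2)) := by
  set M : ℝ := C₃ + √K * β₀ * C₂ with hM
  have hM0 : 0 < M := by positivity
  have hlog2 : 0 < Real.log 2 := Real.log_pos one_lt_two
  have hεK : 0 < ε K := hεpos K le_rfl
  have hsqrt : √(M / ρ) ≤ √(C₃ / ρ) + √(√K * β₀ * C₂ / ρ) := by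
    rw [hM, add_div]
    exact Real.sqrt_add_le_sqrt_add_sqrt_of_nonneg (by positivity) (by positivity)
  have hargM : 9 * (ε K)⁻¹ * D * √(1 / ρ) * M ^ ((3 : ℝ) / 2)
      = 9 * D * M * √(M / ρ) / ε K := by
    rw [mul_assoc, Real.sqrt_one_div_mul_rpow_three_halves hM0]
    ring
  rw [hargM]
  set A : ℝ := 2 * √(C₃ / ρ) + 2 * √(√K * β₀ * C₂ / ρ) + 1 / Real.log 2 with hA
  set B : ℝ := Real.log (9 * D * M * √(M / ρ) / ε K) with hB
  have hterm : ∀ k ∈ Finset.range K,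
      (((⌈max (1 / Real.log 2) (2 * √(L k / ρ)) *
        Real.log (9 * D * L k * √(L k / ρ) / ε k)⌉ : ℤ) : ℝ) + 1) ≤ 2 + A * B := by
    intro k hk
    have hkK : k + 1 ≤ K := Finset.mem_range.mp hk
    have hεk : 0 < ε k := hεpos k (by lia)
    have hεk1 : ε k ≤ 1 := (hεanti 0 k k.zero_le (by lia)).trans hε0
    have hL0 : 0 < L 0 := by rw [hL]; positivity
    have hL0k : L 0 ≤ L k := by
      rw [hL, hL]
      gcongr
      exact k.zero_le
    have hLk0 : 0 < L k := hL0.trans_le hL0k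
    have hLkM : L k ≤ M := by
      rw [hL, hM]
      gcongr
      exact_mod_cast hkK
    have harg1 : 1 ≤ 9 * D * L k * √(L k / ρ) / ε k := by
      rw [le_div_iff₀ hεk, one_mul]
      refine hεk1.trans (hbig.trans ?_)
      gcongr
    have hlog_nonneg := Real.log_nonneg harg1
    have hlog : Real.log (9 * D * L k * √(L k / ρ) / ε k) ≤ B := by
      refine Real.log_le_log (by linarith) ?_
      gcongr
      exact hεanti k K (by lia) le_rfl
    have hmax : max (1 / Real.log 2) (2 * √(L k / ρ)) ≤ A := by
      have h1 : √(L k / ρ) ≤ √(M / ρ) := by gcongr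
      have h2 : 0 < 1 / Real.log 2 := by positivity
      refine max_le ?_ (by linarith)
      linarith [Real.sqrt_nonneg (C₃ / ρ), Real.sqrt_nonneg (√K * β₀ * C₂ / ρ)]
    have hprod := mul_le_mul hmax hlog hlog_nonneg (by positivity)
    linarith [Int.ceil_lt_add_one (max (1 / Real.log 2) (2 * √(L k / ρ)) *
      Real.log (9 * D * L k * √(L k / ρ) / ε k))]
  refine (Finset.sum_le_card_nsmul _ _ _ hterm).trans_eq ?_
  rw [Finset.card_range, nsmul_eq_mul]
  ring
end

section
/- Let c : ℝ^d → ℝ^p be differentiable with its derivative L_c-Lipschitz continuous (in operator norm), and let l : ℝ^p → ℝ be convex and M_l-Lipschitz continuous. Then the composition f := l ∘ c is M_l·L_c-weakly convex; that is, the function x ↦ l(c(x)) + (M_l·L_c/2)·‖x‖² is convex on ℝ^d. -/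
/-- The first-order Taylor estimate for a map with Lipschitz derivative. -/
theorem norm_sub_sub_fderiv_le_of_lipschitz {E F : Type*}
    [NormedAddCommGroup E] [NormedSpace ℝ E] [NormedAddCommGroup F] [NormedSpace ℝ F]
    {c : E → F} {L : ℝ} (hc : Differentiable ℝ c)
    (hL : ∀ x₁ x₂, ‖fderiv ℝ c x₁ - fderiv ℝ c x₂‖ ≤ L * ‖x₁ - x₂‖) (x z : E) :
    ‖c x - c z - fderiv ℝ c z (x - z)‖ ≤ L / 2 * ‖x - z‖ ^ 2 := by
  set v := x - z with hv
  have hline (t : ℝ) : HasDerivAt (fun t : ℝ => z + t • v) v t := by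
    simpa using ((hasDerivAt_id t).smul_const v).const_add z
  have hderiv (t : ℝ) : HasDerivAt (fun t : ℝ => c (z + t • v) - c z - t • fderiv ℝ c z v)
      (fderiv ℝ c (z + t • v) v - fderiv ℝ c z v) t := by
    have h := (hc (z + t • v)).hasFDerivAt.comp_hasDerivAt t (hline t)
    simpa using (h.sub_const (c z)).fun_sub ((hasDerivAt_id t).smul_const (fderiv ℝ c z v))
  have hbound (t : ℝ) : HasDerivAt (fun t : ℝ => L / 2 * ‖v‖ ^ 2 * t ^ 2) (L * ‖v‖ ^ 2 * t) t := by
    exact ((hasDerivAt_pow 2 t).const_mul (L / 2 * ‖v‖ ^ 2)).congr_deriv (by push_cast; ring)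
  have h := image_norm_le_of_norm_deriv_right_le_deriv_boundary (a := 0) (b := 1)
    (fun t _ => (hderiv t).continuousAt.continuousWithinAt)
    (fun t _ => (hderiv t).hasDerivWithinAt) (by simp) hbound
    (fun t ht => by
      calc ‖fderiv ℝ c (z + t • v) v - fderiv ℝ c z v‖
          ≤ ‖fderiv ℝ c (z + t • v) - fderiv ℝ c z‖ * ‖v‖ :=
            (fderiv ℝ c (z + t • v) - fderiv ℝ c z).le_opNorm v
        _ ≤ L * ‖z + t • v - z‖ * ‖v‖ := by gcongr; exact hL _ _
        _ = L * ‖v‖ ^ 2 * t := by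
            rw [add_sub_cancel_left, norm_smul, Real.norm_of_nonneg ht.1]
            ring)
    (Set.right_mem_Icc.2 zero_le_one)
  simpa [hv] using h

/-- The variance identity for a convex combination of two points. -/
theorem convexCombo_norm_sub_sq {E : Type*} [NormedAddCommGroup E] [InnerProductSpace ℝ E]
    (x y : E) {a b : ℝ} (hab : a + b = 1) :
    a * ‖x - (a • x + b • y)‖ ^ 2 + b * ‖y - (a • x + b • y)‖ ^ 2 =
      a * ‖x‖ ^ 2 + b * ‖y‖ ^ 2 - ‖a • x + b • y‖ ^ 2 := by
  have h : a * inner ℝ x (a • x + b • y) + b * inner ℝ y (a • x + b • y) =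
      ‖a • x + b • y‖ ^ 2 := by
    rw [← real_inner_smul_left, ← real_inner_smul_left, ← inner_add_left,
      real_inner_self_eq_norm_sq]
  rw [norm_sub_sq_real, norm_sub_sq_real]
  linear_combination -2 * h + ‖a • x + b • y‖ ^ 2 * hab

/-- A map with Lipschitz derivative is affine up to a quadratic error. -/
theorem norm_convexCombo_sub_le_of_lipschitz_fderiv {E F : Type*}
    [NormedAddCommGroup E] [InnerProductSpace ℝ E] [NormedAddCommGroup F] [NormedSpace ℝ F]
    {c : E → F} {L : ℝ} (hc : Differentiable ℝ c)
    (hL : ∀ x₁ x₂, ‖fderiv ℝ c x₁ - fderiv ℝ c x₂‖ ≤ L * ‖x₁ - x₂‖)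
    (x y : E) {a b : ℝ} (ha : 0 ≤ a) (hb : 0 ≤ b) (hab : a + b = 1) :
    ‖c (a • x + b • y) - (a • c x + b • c y)‖ ≤
      L / 2 * (a * ‖x‖ ^ 2 + b * ‖y‖ ^ 2 - ‖a • x + b • y‖ ^ 2) := by
  rw [← convexCombo_norm_sub_sq x y hab]
  set z := a • x + b • y with hz
  set A := fderiv ℝ c z
  have hA : a • A (x - z) + b • A (y - z) = 0 := by
    rw [← map_smul, ← map_smul, ← map_add, smul_sub, smul_sub, sub_add_sub_comm, ← hz,
      ← add_smul, hab, one_smul, sub_self, map_zero]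
  have hsplit : a • c x + b • c y - c z =
      a • (c x - c z - A (x - z)) + b • (c y - c z - A (y - z)) := by
    have hcz : c z = a • c z + b • c z := by rw [← add_smul, hab, one_smul]
    calc a • c x + b • c y - c z
        = a • c x + b • c y - (a • c z + b • c z) - (a • A (x - z) + b • A (y - z)) := by
          rw [hA, sub_zero, ← hcz]
      _ = _ := by module
  rw [norm_sub_rev, hsplit]
  calc ‖a • (c x - c z - A (x - z)) + b • (c y - c z - A (y - z))‖
      ≤ ‖a • (c x - c z - A (x - z))‖ + ‖b • (c y - c z - A (y - z))‖ := norm_add_le _ _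
    _ = a * ‖c x - c z - A (x - z)‖ + b * ‖c y - c z - A (y - z)‖ := by
        rw [norm_smul, norm_smul, Real.norm_of_nonneg ha, Real.norm_of_nonneg hb]
    _ ≤ a * (L / 2 * ‖x - z‖ ^ 2) + b * (L / 2 * ‖y - z‖ ^ 2) := by
        gcongr <;> exact norm_sub_sub_fderiv_le_of_lipschitz hc hL _ _
    _ = L / 2 * (a * ‖x - z‖ ^ 2 + b * ‖y - z‖ ^ 2) := by ring

/-- Let `c : ℝ^d → ℝ^p` be differentiable with `L_c`-Lipschitz derivative
(in operator norm), and let `l : ℝ^p → ℝ` be convex and `M_l`-Lipschitz continuous. Then the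
composition `f := l ∘ c` is `M_l·L_c`-weakly convex; that is,
`x ↦ l(c(x)) + (M_l·L_c/2)·‖x‖²` is convex on `ℝ^d`. -/
theorem composite_weakly_convex
    (d p : ℕ) (Lc Ml : ℝ) (hLc : 0 ≤ Lc) (hMl : 0 ≤ Ml)
    (c : EuclideanSpace ℝ (Fin d) → EuclideanSpace ℝ (Fin p))
    (hc : Differentiable ℝ c)
    (hclip : ∀ x₁ x₂, ‖fderiv ℝ c x₁ - fderiv ℝ c x₂‖ ≤ Lc * ‖x₁ - x₂‖)
    (l : EuclideanSpace ℝ (Fin p) → ℝ)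
    (hconv : ConvexOn ℝ Set.univ l)
    (hlip : ∀ u w, |l u - l w| ≤ Ml * ‖u - w‖) :
    ConvexOn ℝ Set.univ (fun x => l (c x) + Ml * Lc / 2 * ‖x‖ ^ 2) := by
  refine ⟨convex_univ, fun x _ y _ a b ha hb hab => ?_⟩
  have h_dev := (le_abs_self _).trans (hlip (c (a • x + b • y)) (a • c x + b • c y))
  have h_conv := hconv.2 (Set.mem_univ (c x)) (Set.mem_univ (c y)) ha hb hab
  have h_quad := mul_le_mul_of_nonneg_left
    (norm_convexCombo_sub_le_of_lipschitz_fderiv hc hclip x y ha hb hab) hMl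
  simp only [smul_eq_mul] at h_conv ⊢
  linarith
end

section
/- Let f̂ : ℝ^d → ℝ be strongly convex, let g_1,…,g_m : ℝ^d → ℝ be convex and differentiable, let A ∈ ℝ^{n×d}, b ∈ ℝ^n, and let x* be the minimizer of f̂ over {x : Ax = b, g(x) ≤ 0}. Suppose (x*, p*) with p* = (y*, z*) is a KKT pair: there is a subgradient ξ ∈ ∂f̂(x*) with ξ + Aᵀy* + Σ_i z*_i ∇g_i(x*) = 0, A x* = b, g(x*) ≤ 0, z* ≥ 0, and z*_i g_i(x*) = 0 for all i. Let β > 0 and p = (y, z) with z ≥ 0, let δ ≥ 0, and let x̂ satisfy L_β(x̂; p) ≤ inf_x L_β(x; p) + δ. Define y⁺ := y + β(A x̂ − b), z⁺ := [z + β g(x̂)]_+, and p⁺ := (y⁺, z⁺). Then ‖p⁺ − p*‖² ≤ ‖p − p*‖² + 2βδ. -/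
open scoped RealInnerProductSpace

/-- A convex function lies above its tangent hyperplanes. -/
theorem ConvexOn.add_inner_gradient_le {E : Type*} [NormedAddCommGroup E]
    [InnerProductSpace ℝ E] [CompleteSpace E] {f : E → ℝ} (hf : ConvexOn ℝ Set.univ f)
    {x : E} (hd : DifferentiableAt ℝ f x) (u : E) :
    f x + ⟪gradient f x, u - x⟫ ≤ f u := by
  have hline : ConvexOn ℝ Set.univ (f ∘ AffineMap.lineMap (k := ℝ) x u) :=
    hf.comp_affineMap (AffineMap.lineMap x u)
  have hderiv : HasDerivAt (f ∘ AffineMap.lineMap (k := ℝ) x u)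
      (fderiv ℝ f x (u - x)) 0 := by
    have hx : HasFDerivAt f (fderiv ℝ f x) (AffineMap.lineMap (k := ℝ) x u 0) := by
      simpa using hd.hasFDerivAt
    exact hx.comp_hasDerivAt 0 AffineMap.hasDerivAt_lineMap
  have hslope := hline.le_slope_of_hasDerivAt (Set.mem_univ 0) (Set.mem_univ 1)
    zero_lt_one hderiv
  have hinner : ⟪gradient f x, u - x⟫ = fderiv ℝ f x (u - x) := by
    rw [← toDual_gradient, InnerProductSpace.toDual_apply_apply]
  simp only [slope_def_field, Function.comp_apply, AffineMap.lineMap_apply_one,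
    AffineMap.lineMap_apply_zero, sub_zero, div_one] at hslope
  linarith

/-- The Lagrangian at KKT multipliers is bounded below by the value at the KKT point. -/
theorem le_lagrangian_of_kkt {E F ι : Type*} [Fintype ι]
    [NormedAddCommGroup E] [InnerProductSpace ℝ E] [CompleteSpace E]
    [NormedAddCommGroup F] [InnerProductSpace ℝ F] [CompleteSpace F]
    {A : E →L[ℝ] F} {b : F} {f : E → ℝ} {g : ι → E → ℝ} {x ξ : E} {y : F} {z : ι → ℝ}
    (hg : ∀ i, ConvexOn ℝ Set.univ (g i)) (hd : ∀ i, DifferentiableAt ℝ (g i) x)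
    (hA : A x = b) (hξ : ∀ u, f x + ⟪ξ, u - x⟫ ≤ f u)
    (hstat : ξ + ContinuousLinearMap.adjoint A y + ∑ i, z i • gradient (g i) x = 0)
    (hz : ∀ i, 0 ≤ z i) (hcs : ∀ i, z i * g i x = 0) (u : E) :
    f x ≤ f u + ⟪y, A u - b⟫ + ∑ i, z i * g i u := by
  have hinner : ⟪ξ, u - x⟫ + ⟪y, A u - b⟫ + ∑ i, z i * ⟪gradient (g i) x, u - x⟫ = 0 := by
    have h := congrArg (fun v => ⟪v, u - x⟫) hstat
    simpa only [inner_add_left, sum_inner, real_inner_smul_left, inner_zero_left,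
      ContinuousLinearMap.adjoint_inner_left, map_sub, hA] using h
  have hsum : ∑ i, z i * ⟪gradient (g i) x, u - x⟫ ≤ ∑ i, z i * g i u := by
    refine Finset.sum_le_sum fun i _ => ?_
    have h := mul_le_mul_of_nonneg_left ((hg i).add_inner_gradient_le (hd i) u) (hz i)
    rw [mul_add, hcs i, zero_add] at h
    exact h
  linarith [hξ u]

/-- Let `f̂ : ℝ^d → ℝ` be strongly convex, `g_1,…,g_m` convex and
differentiable, `A ∈ ℝ^{n×d}`, `b ∈ ℝ^n`, and let `x*` be the minimizer of `f̂` over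
`{x : Ax = b, g(x) ≤ 0}`. Suppose `(x*, p*)` with `p* = (y*, z*)` is a KKT pair. Let `β > 0`
and `p = (y, z)` with `z ≥ 0`, `δ ≥ 0`, and let `x̂` satisfy
`L_β(x̂; p) ≤ inf_x L_β(x; p) + δ`, where
`L_β(x; p) := f̂(x) + ⟨y, Ax−b⟩ + (β/2)‖Ax−b‖² + (β/2)‖[g(x)+z/β]_+‖² − ‖z‖²/(2β)`.
Define `y⁺ := y + β(Ax̂−b)`, `z⁺ := [z + βg(x̂)]_+`. Then
`‖p⁺ − p*‖² ≤ ‖p − p*‖² + 2βδ` (squared Euclidean norm of the concatenated pair). -/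
theorem inexact_alm_dual_nonexpansive
    (d n m : ℕ)
    (A : EuclideanSpace ℝ (Fin d) →L[ℝ] EuclideanSpace ℝ (Fin n))
    (b : EuclideanSpace ℝ (Fin n))
    (fhat : EuclideanSpace ℝ (Fin d) → ℝ)
    (μ : ℝ) (hμ : 0 < μ)
    (hfhat : ConvexOn ℝ Set.univ (fun x => fhat x - μ / 2 * ‖x‖ ^ 2))
    (g : Fin m → EuclideanSpace ℝ (Fin d) → ℝ)
    (hgconv : ∀ i, ConvexOn ℝ Set.univ (g i))
    (hgdiff : ∀ i, Differentiable ℝ (g i))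
    (xstar : EuclideanSpace ℝ (Fin d))
    (hfeas : A xstar = b ∧ ∀ i, g i xstar ≤ 0)
    (hmin : ∀ x, A x = b → (∀ i, g i x ≤ 0) → fhat xstar ≤ fhat x)
    (ystar : EuclideanSpace ℝ (Fin n)) (zstar : Fin m → ℝ)
    (ξ : EuclideanSpace ℝ (Fin d))
    (hξ : ∀ u, fhat xstar + ⟪ξ, u - xstar⟫ ≤ fhat u)
    (hstat : ξ + ContinuousLinearMap.adjoint A ystar
        + ∑ i, zstar i • gradient (g i) xstar = 0)
    (hzstar : ∀ i, 0 ≤ zstar i)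
    (hcs : ∀ i, zstar i * g i xstar = 0)
    (β : ℝ) (hβ : 0 < β)
    (y : EuclideanSpace ℝ (Fin n)) (z : Fin m → ℝ) (hz : ∀ i, 0 ≤ z i)
    (δ : ℝ) (hδ : 0 ≤ δ)
    (Lag : EuclideanSpace ℝ (Fin d) → ℝ)
    (hLag : ∀ x, Lag x = fhat x + ⟪y, A x - b⟫ + β / 2 * ‖A x - b‖ ^ 2
        + β / 2 * ∑ i, max (g i x + z i / β) 0 ^ 2 - (∑ i, z i ^ 2) / (2 * β))
    (xhat : EuclideanSpace ℝ (Fin d))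
    (hxhat : ∀ x, Lag xhat ≤ Lag x + δ)
    (yplus : EuclideanSpace ℝ (Fin n)) (zplus : Fin m → ℝ)
    (hyplus : yplus = y + β • (A xhat - b))
    (hzplus : ∀ i, zplus i = max (z i + β * g i xhat) 0) :
    ‖yplus - ystar‖ ^ 2 + ∑ i, (zplus i - zstar i) ^ 2 ≤
      ‖y - ystar‖ ^ 2 + (∑ i, (z i - zstar i) ^ 2) + 2 * β * δ := by
  have hlower := le_lagrangian_of_kkt hgconv (fun i => hgdiff i xstar) hfeas.1 hξ hstat
    hzstar hcs xhat
  have hupper := hxhat xstar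
  rw [hLag, hLag, hfeas.1] at hupper
  simp only [sub_self, inner_zero_right, norm_zero] at hupper
  have hstar : ∑ i, max (g i xstar + z i / β) 0 ^ 2 ≤ (∑ i, z i ^ 2) / β ^ 2 := by
    rw [Finset.sum_div]
    refine Finset.sum_le_sum fun i _ => ?_
    rw [← div_pow]
    exact pow_le_pow_left₀ (le_max_right _ _)
      (max_le (by linarith [hfeas.2 i]) (div_nonneg (hz i) hβ.le)) 2
  have hhat : ∑ i, max (g i xhat + z i / β) 0 ^ 2 = (∑ i, zplus i ^ 2) / β ^ 2 := by
    rw [Finset.sum_div]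
    refine Finset.sum_congr rfl fun i _ => ?_
    rw [← div_pow, hzplus, ← max_div_div_right hβ.le, zero_div]
    congr 2
    field_simp
    ring
  have hcoord : ∑ i, (zplus i - zstar i) ^ 2 ≤ (∑ i, (z i - zstar i) ^ 2)
      + ∑ i, zplus i ^ 2 - ∑ i, z i ^ 2 - 2 * β * ∑ i, zstar i * g i xhat := by
    rw [Finset.mul_sum, ← Finset.sum_add_distrib, ← Finset.sum_sub_distrib,
      ← Finset.sum_sub_distrib]
    refine Finset.sum_le_sum fun i _ => ?_
    have h : z i + β * g i xhat ≤ zplus i := hzplus i ▸ le_max_left _ _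
    nlinarith [mul_le_mul_of_nonneg_left h (hzstar i)]
  have hnorm : ‖yplus - ystar‖ ^ 2 = ‖y - ystar‖ ^ 2
      + 2 * β * (⟪y, A xhat - b⟫ - ⟪ystar, A xhat - b⟫) + β ^ 2 * ‖A xhat - b‖ ^ 2 := by
    rw [hyplus, add_sub_right_comm, norm_add_sq_real, real_inner_smul_right, inner_sub_left,
      norm_smul, mul_pow, Real.norm_eq_abs, sq_abs]
    ring
  have hscale (s : ℝ) : β / 2 * (s / β ^ 2) = s / (2 * β) := by field_simp
  have hstar' := mul_le_mul_of_nonneg_left hstar (half_pos hβ).le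
  rw [hscale] at hstar'
  rw [hhat, hscale] at hupper
  have hgap : ⟪y, A xhat - b⟫ - ⟪ystar, A xhat - b⟫ - ∑ i, zstar i * g i xhat
      + β / 2 * ‖A xhat - b‖ ^ 2 + (∑ i, zplus i ^ 2) / (2 * β)
      - (∑ i, z i ^ 2) / (2 * β) ≤ δ := by
    linarith
  have hgap' := mul_le_mul_of_nonneg_left hgap (by positivity : 0 ≤ 2 * β)
  have hcancel (s : ℝ) : 2 * β * (s / (2 * β)) = s := mul_div_cancel₀ s (by positivity)
  rw [mul_sub, mul_add, hcancel, hcancel] at hgap'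
  rw [hnorm]
  linarith
end
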